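/- Let s ∈ ℕ with s ≥ 2, let T₀ > 0, Λ ≥ 1, B ≥ 1, 𝔠₀ > 0, η₁, η₂ ≥ 0, ε ∈ (0,1] and p ∈ [1,2]. Let φ_eik ∈ C^∞([0,T₀] × ℝ³; ℝ) with sup_{[0,T₀]×ℝ³} |∂_x^σ φ_eik| ≤ Λ for all multi-indices σ with 1 ≤ |σ| ≤ s + 2. Let K ∈ L¹(ℝ³) with K ≥ 0, ε⁻¹‖K‖_{L¹} ≤ Λ, |ε⁻¹∫ K dx − 4π𝔠₀| ≤ η₁ and ε⁻¹∫ |x| K(x) dx ≤ η₂. Let a^ε ∈ C^∞([0,T₀] × ℝ³; ℂ), Schwartz in x, solve the amplitude equation ∂_t a^ε + ∇φ_eik·∇a^ε + (1/2) a^ε Δφ_eik = i(ε/2)Δa^ε − i ε⁻¹ (K ∗ |a^ε|²) a^ε with sup_t ‖a^ε(t)‖_{H^s} ≤ B, and let a, Schwartz in x, solve ∂_t a + ∇φ_eik·∇a + (1/2) a Δφ_eik = −i 4π𝔠₀ |a|² a with sup_t ‖a(t)‖_{H^{s+2}} ≤ B (eikonal system with capacity constant). Set φ^ε := a^ε e^{iφ_eik/ε},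 ρ^ε := |φ^ε|², J^ε := Im(ε∇φ^ε · conj(φ^ε)). Then there exists C > 0, depending only on s, p, T₀, Λ, B and 𝔠₀, such that, with D := ‖a^ε(0) − a(0)‖_{H^s} + ε + η₁ + η₂: sup_{t∈[0,T₀]} ‖ρ^ε(t) − |a(t)|²‖_{L^p} ≤ C·D, sup_{t∈[0,T₀]} ‖J^ε(t) − |a(t)|² ∇φ_eik(t)‖_{L^p} ≤ C·D, and sup_{t∈[0,T₀]} ‖ |ε∇φ^ε(t)|² − |a(t)|² |∇φ_eik(t)|² ‖_{L¹} ≤ C·D. (WKB derivation of the mass, momentum and kinetic-energy densities of the eikonal system in the critical beyond-Gross–Pitaevskii regime κ = 1/2.) -/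

import Mathlib

noncomputable section

open MeasureTheory Real Set

/-- Three-dimensional Euclidean space `ℝ³`. -/
abbrev E3 := EuclideanSpace ℝ (Fin 3)

/-- The `i`-th standard basis vector of `ℝ³`. -/
def e3 (i : Fin 3) : E3 := EuclideanSpace.single i 1

/-- Partial derivative `∂ᵢ` of a complex-valued function on `ℝ³`. -/
def pd (i : Fin 3) (g : E3 → ℂ) : E3 → ℂ := fun x => fderiv ℝ g x (e3 i)

/-- Partial derivative `∂ᵢ` of a real-valued function on `ℝ³`. -/
def pdR (i : Fin 3) (g : E3 → ℝ) : E3 → ℝ := fun x => fderiv ℝ g x (e3 i)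

/-- Multi-index partial derivative `∂^σ` of a complex-valued function. -/
def mpd (σ : Fin 3 → ℕ) (g : E3 → ℂ) : E3 → ℂ :=
  (pd 0)^[σ 0] ((pd 1)^[σ 1] ((pd 2)^[σ 2] g))

/-- Multi-index partial derivative `∂^σ` of a real-valued function. -/
def mpdR (σ : Fin 3 → ℕ) (g : E3 → ℝ) : E3 → ℝ :=
  (pdR 0)^[σ 0] ((pdR 1)^[σ 1] ((pdR 2)^[σ 2] g))

/-- Degree `|σ|` of a multi-index `σ ∈ ℕ³`. -/
def mdeg (σ : Fin 3 → ℕ) : ℕ := σ 0 + σ 1 + σ 2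

/-- The finite set of multi-indices `σ ∈ ℕ³` with `|σ| ≤ s`. -/
def mIdx (s : ℕ) : Finset (Fin 3 → ℕ) :=
  (Fintype.piFinset fun _ : Fin 3 => Finset.range (s + 1)).filter fun σ => mdeg σ ≤ s

/-- Sobolev norm `‖g‖_{H^s}`, `‖g‖_{H^s}² = Σ_{|σ| ≤ s} ‖∂^σ g‖²_{L²}`. -/
def sobNorm (s : ℕ) (g : E3 → ℂ) : ℝ :=
  Real.sqrt (∑ σ ∈ mIdx s, ∫ x : E3, ‖mpd σ g x‖ ^ 2)

/-- Semiclassical Sobolev norm `‖g‖_{H^s_ε}`,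
`‖g‖²_{H^s_ε} = Σ_{|σ| ≤ s} ε^{2|σ|} ‖∂^σ g‖²_{L²}`. -/
def sobNormE (ε : ℝ) (s : ℕ) (g : E3 → ℂ) : ℝ :=
  Real.sqrt (∑ σ ∈ mIdx s, ε ^ (2 * mdeg σ) * ∫ x : E3, ‖mpd σ g x‖ ^ 2)

/-- Laplacian of a complex-valued function on `ℝ³`. -/
def lapC (g : E3 → ℂ) : E3 → ℂ := fun x => ∑ i : Fin 3, pd i (pd i g) x

/-- Laplacian of a real-valued function on `ℝ³`. -/
def lapR (g : E3 → ℝ) : E3 → ℝ := fun x => ∑ i : Fin 3, pdR i (pdR i g) x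

/-- Convolution `(W ∗ g)(x) = ∫ W(x - y) g(y) dy` on `ℝ³`. -/
def conv3 (W g : E3 → ℝ) : E3 → ℝ := fun x => ∫ y : E3, W (x - y) * g y

/-- A function on `ℝ³` of Schwartz class: smooth with all derivatives rapidly decaying. -/
def IsSchwartzF {F : Type*} [NormedAddCommGroup F] [NormedSpace ℝ F] (g : E3 → F) : Prop :=
  (∀ n : ℕ, ContDiff ℝ n g) ∧
    ∀ k n : ℕ, ∃ C : ℝ, ∀ x : E3, ‖x‖ ^ k * ‖iteratedFDeriv ℝ n g x‖ ≤ C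

open scoped SchwartzMap FourierTransform LineDeriv

theorem IsSchwartzF.exists_schwartzMap {g : E3 → ℂ} (hg : IsSchwartzF g) :
    ∃ f : 𝓢(E3, ℂ), ⇑f = g :=
  ⟨⟨g, contDiff_infty.2 hg.1, hg.2⟩, rfl⟩

theorem pd_schwartzMap (i : Fin 3) (f : 𝓢(E3, ℂ)) : pd i ⇑f = ⇑(∂_{e3 i} f : 𝓢(E3, ℂ)) := by
  funext x
  exact (SchwartzMap.lineDerivOp_apply_eq_fderiv (e3 i) f x).symm

theorem norm_fourier_pd_pd (i : Fin 3) (f : 𝓢(E3, ℂ)) (ξ : E3) :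
    ‖𝓕 (∂_{e3 i} (∂_{e3 i} f)) ξ‖ = (2 * π) ^ 2 * (ξ i) ^ 2 * ‖𝓕 f ξ‖ := by
  have key : ∀ g : 𝓢(E3, ℂ), ‖𝓕 (∂_{e3 i} g) ξ‖ = 2 * π * |ξ i| * ‖𝓕 g ξ‖ := by
    intro g
    rw [SchwartzMap.fourier_lineDerivOp_eq]
    have ht : (fun x : E3 => inner ℝ x (e3 i)).HasTemperateGrowth := by fun_prop
    have hin : inner ℝ ξ (e3 i) = ξ i := by
      rw [e3, EuclideanSpace.inner_single_right]; simp
    rw [smul_apply, SchwartzMap.smulLeftCLM_apply_apply ht, hin]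
    simp [abs_of_pos Real.pi_pos]
    ring
  rw [key, key, ← sq_abs (ξ i)]
  ring

theorem exists_sobolev_sup_bound :
    ∃ C₀ : ℝ, ∀ f : 𝓢(E3, ℂ), ∀ x, ‖f x‖ ≤ C₀ + 2 * ((∫ y, ‖f y‖ ^ 2) +
      ∑ i : Fin 3, ∫ y, ‖pd i (pd i ⇑f) y‖ ^ 2) := by
  refine ⟨∫ ξ : E3, (1 + ‖ξ‖ ^ 2) ^ (-(4 : ℝ) / 2), fun f x => ?_⟩
  have hJ : Integrable fun ξ : E3 => (1 + ‖ξ‖ ^ 2) ^ (-(4 : ℝ) / 2) :=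
    integrable_rpow_neg_one_add_norm_sq (by simp; norm_num)
  have hL2 : ∀ g : 𝓢(E3, ℂ), Integrable fun ξ => ‖g ξ‖ ^ 2 := fun g =>
    (g.memLp 2).integrable_norm_pow (by norm_num)
  have h1 : ‖f x‖ ≤ ∫ ξ, ‖𝓕 f ξ‖ := by
    have : f x = 𝓕⁻ (𝓕 f) x := by rw [FourierTransform.fourierInv_fourier_eq]
    rw [this, SchwartzMap.fourierInv_coe, Real.fourierInv_eq]
    refine (norm_integral_le_integral_norm _).trans (le_of_eq ?_)
    congr 1; funext ξ; simp
  have h2 : ∀ ξ : E3, ‖𝓕 f ξ‖ ≤ (1 + ‖ξ‖ ^ 2) ^ (-(4 : ℝ) / 2) +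
      2 * (‖𝓕 f ξ‖ ^ 2 + ∑ i : Fin 3, ‖𝓕 (∂_{e3 i} (∂_{e3 i} f)) ξ‖ ^ 2) := by
    intro ξ
    set n := ‖𝓕 f ξ‖
    have hn : 0 ≤ n := norm_nonneg _
    have hq : (1 + ‖ξ‖ ^ 2) ^ (-(4 : ℝ) / 2) = ((1 + ‖ξ‖ ^ 2)⁻¹) ^ 2 := by
      rw [show (-(4 : ℝ) / 2) = -((2 : ℕ) : ℝ) by norm_num, Real.rpow_neg (by positivity),
        Real.rpow_natCast, inv_pow]
    rw [hq]
    set q := 1 + ‖ξ‖ ^ 2 with hqd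
    have hq0 : 0 < q := by positivity
    have hA : n ≤ (q⁻¹) ^ 2 + (q * n) ^ 2 / 2 := by
      have h := two_mul_le_add_sq q⁻¹ (q * n)
      have h' : 2 * q⁻¹ * (q * n) = 2 * n := by field_simp
      nlinarith [sq_nonneg q⁻¹]
    have hB : q ^ 2 ≤ 4 * (1 + ∑ i : Fin 3, (ξ i) ^ 4) := by
      rw [hqd, EuclideanSpace.norm_sq_eq]
      simp only [Fin.sum_univ_three, Real.norm_eq_abs, sq_abs]
      nlinarith [sq_nonneg ((ξ 0) ^ 2 - (ξ 1) ^ 2), sq_nonneg ((ξ 0) ^ 2 - (ξ 2) ^ 2),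
        sq_nonneg ((ξ 1) ^ 2 - (ξ 2) ^ 2), sq_nonneg (1 - (ξ 0) ^ 2),
        sq_nonneg (1 - (ξ 1) ^ 2), sq_nonneg (1 - (ξ 2) ^ 2)]
    have hC : ∀ i : Fin 3, (ξ i) ^ 4 * n ^ 2 ≤ ‖𝓕 (∂_{e3 i} (∂_{e3 i} f)) ξ‖ ^ 2 := by
      intro i
      rw [norm_fourier_pd_pd]
      have hpi : 1 ≤ (2 * π) ^ 4 := one_le_pow₀ (by linarith [Real.pi_gt_three])
      have : 0 ≤ (ξ i) ^ 4 * n ^ 2 := by positivity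
      calc (ξ i) ^ 4 * n ^ 2 ≤ (2 * π) ^ 4 * ((ξ i) ^ 4 * n ^ 2) := by nlinarith
        _ = _ := by ring
    have hD := Finset.sum_le_sum fun i (_ : i ∈ Finset.univ) => hC i
    rw [← Finset.sum_mul] at hD
    have hE := mul_le_mul_of_nonneg_right hB (sq_nonneg n)
    nlinarith
  have hInt : Integrable fun ξ : E3 => 2 * (‖𝓕 f ξ‖ ^ 2 +
      ∑ i : Fin 3, ‖𝓕 (∂_{e3 i} (∂_{e3 i} f)) ξ‖ ^ 2) :=
    ((hL2 _).add (integrable_finsetSum _ fun i _ => hL2 _)).const_mul 2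
  calc ‖f x‖ ≤ ∫ ξ, ‖𝓕 f ξ‖ := h1
    _ ≤ ∫ ξ, ((1 + ‖ξ‖ ^ 2) ^ (-(4 : ℝ) / 2) +
      2 * (‖𝓕 f ξ‖ ^ 2 + ∑ i : Fin 3, ‖𝓕 (∂_{e3 i} (∂_{e3 i} f)) ξ‖ ^ 2)) :=
        integral_mono (𝓕 f).integrable.norm (hJ.add hInt) h2
    _ = _ := by
      rw [integral_add hJ hInt, integral_const_mul,
        integral_add (hL2 _) (integrable_finsetSum _ fun i _ => hL2 _),
        integral_finsetSum _ fun i _ => hL2 _]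
      simp only [SchwartzMap.integral_norm_sq_fourier, pd_schwartzMap]

theorem contDiff_slice {F : Type*} [NormedAddCommGroup F] [NormedSpace ℝ F] {n : WithTop ℕ∞}
    {u : ℝ → E3 → F} {S : Set ℝ}
    (hu : ContDiffOn ℝ n (fun q : ℝ × E3 => u q.1 q.2) (S ×ˢ univ)) {t : ℝ} (ht : t ∈ S) :
    ContDiff ℝ n (u t) := by
  rw [← contDiffOn_univ]
  exact hu.comp (g := fun q : ℝ × E3 => u q.1 q.2) (f := fun x : E3 => (t, x))
    (by fun_prop) fun x _ => ⟨ht, mem_univ _⟩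

theorem hasDerivWithinAt_slice {F : Type*} [NormedAddCommGroup F] [NormedSpace ℝ F]
    {u : ℝ → E3 → F} {S : Set ℝ}
    (hu : ContDiffOn ℝ 1 (fun q : ℝ × E3 => u q.1 q.2) (S ×ˢ univ)) {t : ℝ} (ht : t ∈ S)
    (x : E3) :
    HasDerivWithinAt (fun τ => u τ x)
      (fderivWithin ℝ (fun q : ℝ × E3 => u q.1 q.2) (S ×ˢ univ) (t, x) (1, 0)) S t := by
  have h1 := (hu.differentiableOn one_ne_zero (t, x) ⟨ht, mem_univ _⟩).hasFDerivWithinAt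
  have h2 : HasDerivWithinAt (fun τ : ℝ => (τ, x)) ((1 : ℝ), (0 : E3)) S t :=
    ((hasDerivAt_id t).prodMk (hasDerivAt_const t x)).hasDerivWithinAt
  have h3 : MapsTo (fun τ : ℝ => (τ, x)) S (S ×ˢ univ) := fun τ hτ => ⟨hτ, mem_univ _⟩
  exact h1.comp_hasDerivWithinAt t h2 h3

theorem continuousOn_derivWithin_slice {F : Type*} [NormedAddCommGroup F] [NormedSpace ℝ F]
    {T : ℝ} (hT : 0 < T) {u : ℝ → E3 → F}
    (hu : ContDiffOn ℝ 1 (fun q : ℝ × E3 => u q.1 q.2) (Icc 0 T ×ˢ univ)) :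
    ContinuousOn (fun q : ℝ × E3 => derivWithin (fun τ => u τ q.2) (Icc 0 T) q.1)
      (Icc 0 T ×ˢ univ) := by
  have hud : UniqueDiffOn ℝ (Icc (0 : ℝ) T ×ˢ (univ : Set E3)) :=
    (uniqueDiffOn_Icc hT).prod uniqueDiffOn_univ
  have h1 := (hu.continuousOn_fderivWithin hud le_rfl).clm_apply
    (continuousOn_const (c := ((1 : ℝ), (0 : E3))))
  refine h1.congr fun q hq => ?_
  exact (hasDerivWithinAt_slice hu hq.1 q.2).derivWithin (uniqueDiffOn_Icc hT q.1 hq.1)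

theorem integral_sub_eq_integral_derivWithin {T : ℝ} (hT : 0 < T) {u : ℝ → E3 → ℝ}
    (hu : ContDiffOn ℝ 1 (fun q : ℝ × E3 => u q.1 q.2) (Icc 0 T ×ˢ univ)) {N : ℝ}
    (hui : ∀ t ∈ Icc 0 T, Integrable (u t))
    (hdi : ∀ t ∈ Icc 0 T, Integrable fun x => derivWithin (fun τ => u τ x) (Icc 0 T) t)
    (hdN : ∀ t ∈ Icc 0 T, ∫ x, ‖derivWithin (fun τ => u τ x) (Icc 0 T) t‖ ≤ N)
    {t : ℝ} (ht : t ∈ Icc 0 T) :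
    (∫ x, u t x) - ∫ x, u 0 x =
      ∫ τ in Ioc 0 t, ∫ x, derivWithin (fun τ => u τ x) (Icc 0 T) τ := by
  set v : ℝ → E3 → ℝ := fun τ x => derivWithin (fun τ => u τ x) (Icc 0 T) τ with hv
  have hvc : ContinuousOn (fun q : ℝ × E3 => v q.1 q.2) (Icc 0 T ×ˢ univ) :=
    continuousOn_derivWithin_slice hT hu
  have hsub : Ioc 0 t ⊆ Icc 0 T := fun τ hτ => ⟨hτ.1.le, hτ.2.trans ht.2⟩
  have h0 : (0 : ℝ) ∈ Icc 0 T := ⟨le_rfl, hT.le⟩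
  have hmeas : AEStronglyMeasurable (fun q : ℝ × E3 => v q.1 q.2)
      ((volume.restrict (Ioc 0 t)).prod (volume : Measure E3)) := by
    have : (volume.restrict (Ioc 0 t)).prod (volume : Measure E3) =
        ((volume : Measure ℝ).prod (volume : Measure E3)).restrict (Ioc 0 t ×ˢ univ) := by
      rw [← Measure.prod_restrict, Measure.restrict_univ]
    rw [this]
    exact (hvc.mono (prod_mono hsub Subset.rfl)).aestronglyMeasurable
      (measurableSet_Ioc.prod MeasurableSet.univ)
  have hInt : Integrable (fun q : ℝ × E3 => v q.1 q.2)
      ((volume.restrict (Ioc 0 t)).prod (volume : Measure E3)) := by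
    rw [integrable_prod_iff hmeas]
    constructor
    · filter_upwards [ae_restrict_mem measurableSet_Ioc] with τ hτ
      exact hdi τ (hsub hτ)
    · refine Integrable.mono' (g := fun _ => N) (integrable_const _)
        hmeas.norm.integral_prod_right' ?_
      filter_upwards [ae_restrict_mem measurableSet_Ioc] with τ hτ
      rw [Real.norm_of_nonneg (integral_nonneg fun x => norm_nonneg _)]
      exact hdN τ (hsub hτ)
  have hpt : ∀ x, u t x - u 0 x = ∫ τ in Ioc 0 t, v τ x := by
    intro x
    have hsubI : Icc 0 t ⊆ Icc 0 T := Icc_subset_Icc_right ht.2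
    have hcx : ContinuousOn (fun τ => v τ x) (Icc 0 T) :=
      hvc.comp (f := fun τ : ℝ => (τ, x)) (by fun_prop) fun τ hτ => ⟨hτ, mem_univ _⟩
    have hd : ∀ τ ∈ Icc 0 T, HasDerivWithinAt (fun τ => u τ x) (v τ x) (Icc 0 T) τ :=
      fun τ hτ => (hasDerivWithinAt_slice hu hτ x).differentiableWithinAt.hasDerivWithinAt
    rw [← intervalIntegral.integral_of_le ht.1]
    refine (intervalIntegral.integral_eq_sub_of_hasDerivAt_of_le ht.1
      (fun τ hτ => (hd τ (hsubI hτ)).continuousWithinAt.mono hsubI)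
      (fun τ hτ => (hd τ (hsubI ⟨hτ.1.le, hτ.2.le⟩)).hasDerivAt
        (Icc_mem_nhds hτ.1 (hτ.2.trans_le ht.2))) ?_).symm
    exact ContinuousOn.intervalIntegrable (by rw [uIcc_of_le ht.1]; exact hcx.mono hsubI)
  rw [← integral_sub (hui t ht) (hui 0 h0)]
  simp_rw [hpt]
  exact (integral_integral_swap hInt).symm

theorem transport_convex_estimate {T Λ M N L E₀ : ℝ} (hT : 0 < T) (hΛ : 0 ≤ Λ) (hL : 0 ≤ L)
    {W G E φ : ℝ → E3 → ℝ} {h h' : ℝ → ℝ}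
    (hW : ContDiffOn ℝ 1 (fun q : ℝ × E3 => W q.1 q.2) (Icc 0 T ×ˢ univ))
    (hWi : ∀ t ∈ Icc 0 T, Integrable (W t)) (hWN : ∀ t ∈ Icc 0 T, ∫ x, |W t x| ≤ N)
    (hWM : ∀ t ∈ Icc 0 T, ∀ x, |W t x| ≤ M)
    (hdi : ∀ t ∈ Icc 0 T, ∀ i, Integrable (pdR i (W t)))
    (hdN : ∀ t ∈ Icc 0 T, ∀ i, ∫ x, |pdR i (W t) x| ≤ N)
    (hGi : ∀ t ∈ Icc 0 T, Integrable (G t)) (hGN : ∀ t ∈ Icc 0 T, ∫ x, |G t x| ≤ N)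
    (hφ : ∀ t ∈ Icc 0 T, ContDiff ℝ 2 (φ t))
    (hφ1 : ∀ t ∈ Icc 0 T, ∀ i x, |pdR i (φ t) x| ≤ Λ)
    (hφ2 : ∀ t ∈ Icc 0 T, ∀ i x, |pdR i (pdR i (φ t)) x| ≤ Λ)
    (heq : ∀ t ∈ Icc 0 T, ∀ x, derivWithin (fun τ => W τ x) (Icc 0 T) t =
      -(∑ i : Fin 3, pdR i (φ t) x * pdR i (W t) x) - W t x * lapR (φ t) x + G t x)
    (hh : ContDiff ℝ 1 h) (hd : ∀ w, HasDerivAt h (h' w) w)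
    (hpos : ∀ w, 0 ≤ h w) (hhL : ∀ w, |w| ≤ M → h w ≤ L * |w|)
    (hh'L : ∀ w, |w| ≤ M → |h' w| ≤ L) (hconv : ∀ w, |h w - h' w * w| ≤ h w)
    (hEi : ∀ t ∈ Icc 0 T, Integrable (E t)) (hE : ∀ t ∈ Icc 0 T, ∫ x, E t x ≤ E₀)
    (hGE : ∀ t ∈ Icc 0 T, ∀ x, |h' (W t x) * G t x| ≤ h (W t x) + E t x) (hE₀ : 0 ≤ E₀)
    {t : ℝ} (ht : t ∈ Icc 0 T) :
    ∫ x, h (W t x) ≤ exp ((3 * Λ + 1) * T) * ((∫ x, h (W 0 x)) + T * E₀) := by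
  set lam := 3 * Λ + 1 with hlam
  have hlam0 : 0 < lam := by positivity
  set u : ℝ → E3 → ℝ := fun τ x => exp (-lam * τ) * h (W τ x) with hu_def
  have hu : ContDiffOn ℝ 1 (fun q : ℝ × E3 => u q.1 q.2) (Icc 0 T ×ˢ univ) := by
    refine ContDiffOn.mul ?_ (hh.comp_contDiffOn hW)
    exact (ContDiff.exp (contDiff_const.mul contDiff_fst)).contDiffOn
  have hWc : ∀ τ ∈ Icc 0 T, ContDiff ℝ 1 (W τ) := fun τ hτ => contDiff_slice hW hτ
  have hh'c : Continuous h' := by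
    have : h' = deriv h := funext fun w => (hd w).deriv.symm
    rw [this]; exact hh.continuous_deriv le_rfl
  have hhi : ∀ τ ∈ Icc 0 T, Integrable fun x => h (W τ x) := by
    intro τ hτ
    refine ((hWi τ hτ).norm.const_mul L).mono'
      (hh.continuous.comp (hWc τ hτ).continuous).aestronglyMeasurable ?_
    filter_upwards with x
    rw [Real.norm_of_nonneg (hpos _)]
    exact hhL _ (hWM τ hτ x)
  have hfd : ∀ τ ∈ Icc 0 T, ∀ i x, fderiv ℝ (fun y => h (W τ y)) x (e3 i) =
      h' (W τ x) * pdR i (W τ) x := by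
    intro τ hτ i x
    have := ((hd (W τ x)).comp_hasFDerivAt x
      ((hWc τ hτ).differentiable one_ne_zero x).hasFDerivAt).fderiv
    change fderiv ℝ (h ∘ W τ) x (e3 i) = _
    rw [this]; rfl
  have hder : ∀ τ ∈ Icc 0 T, ∀ x, derivWithin (fun τ => u τ x) (Icc 0 T) τ =
      exp (-lam * τ) * (-(∑ i : Fin 3, fderiv ℝ (fun y => h (W τ y)) x (e3 i) * pdR i (φ τ) x) -
        h' (W τ x) * W τ x * lapR (φ τ) x + h' (W τ x) * G τ x - lam * h (W τ x)) := by
    intro τ hτ x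
    have h1 := (hasDerivWithinAt_slice hW hτ x).differentiableWithinAt.hasDerivWithinAt
    have h2 := (hd (W τ x)).comp_hasDerivWithinAt τ h1
    have h3 : HasDerivWithinAt (fun τ => exp (-lam * τ)) (exp (-lam * τ) * (-lam)) (Icc 0 T) τ := by
      simpa using (((hasDerivAt_id τ).const_mul (-lam)).exp).hasDerivWithinAt
    have h4 : derivWithin (fun τ => u τ x) (Icc 0 T) τ = _ :=
      (h3.mul h2).derivWithin (uniqueDiffOn_Icc hT τ hτ)
    rw [h4, heq τ hτ x]
    simp only [hfd τ hτ, Fin.sum_univ_three, Function.comp]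
    ring
  have hφ1c : ∀ τ ∈ Icc 0 T, ∀ i, ContDiff ℝ 1 (pdR i (φ τ)) := fun τ hτ i =>
    ((hφ τ hτ).fderiv_right (m := 1) (by norm_num)).clm_apply contDiff_const
  have hφ2c : ∀ τ ∈ Icc 0 T, ∀ i, Continuous (pdR i (pdR i (φ τ))) := fun τ hτ i =>
    ((hφ1c τ hτ i).continuous_fderiv one_ne_zero).clm_apply continuous_const
  have hWd : ∀ τ ∈ Icc 0 T, ∀ i, Continuous (pdR i (W τ)) := fun τ hτ i =>
    ((hWc τ hτ).continuous_fderiv one_ne_zero).clm_apply continuous_const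
  have hh'W : ∀ τ ∈ Icc 0 T, Continuous fun x => h' (W τ x) := fun τ hτ =>
    hh'c.comp (hWc τ hτ).continuous
  have hA : ∀ τ ∈ Icc 0 T, ∀ i, Integrable fun x =>
      fderiv ℝ (fun y => h (W τ y)) x (e3 i) * pdR i (φ τ) x := by
    intro τ hτ i
    simp only [hfd τ hτ]
    refine (((hdi τ hτ i).norm.const_mul (L * Λ))).mono' (((hh'W τ hτ).mul (hWd τ hτ i)).mul
      (hφ1c τ hτ i).continuous).aestronglyMeasurable ?_
    filter_upwards with x
    rw [norm_mul, norm_mul]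
    have h1 := hh'L _ (hWM τ hτ x)
    have h2 := hφ1 τ hτ i x
    calc ‖h' (W τ x)‖ * ‖pdR i (W τ) x‖ * ‖pdR i (φ τ) x‖
        ≤ L * ‖pdR i (W τ) x‖ * Λ := by gcongr <;> assumption
      _ = _ := by ring
  have hB : ∀ τ ∈ Icc 0 T, ∀ i, Integrable fun x =>
      h (W τ x) * pdR i (pdR i (φ τ)) x := by
    intro τ hτ i
    refine ((hhi τ hτ).const_mul Λ).mono' ((hh.continuous.comp (hWc τ hτ).continuous).mul
      (hφ2c τ hτ i)).aestronglyMeasurable ?_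
    filter_upwards with x
    rw [norm_mul, Real.norm_of_nonneg (hpos _), mul_comm]
    exact mul_le_mul_of_nonneg_right (hφ2 τ hτ i x) (hpos _)
  have hlapb : ∀ τ ∈ Icc 0 T, ∀ x, |lapR (φ τ) x| ≤ 3 * Λ := by
    intro τ hτ x
    refine (Finset.abs_sum_le_sum_abs _ _).trans ?_
    refine (Finset.sum_le_sum fun i _ => hφ2 τ hτ i x).trans ?_
    simp
  have hlapc : ∀ τ ∈ Icc 0 T, Continuous (lapR (φ τ)) := fun τ hτ =>
    continuous_finsetSum _ fun i _ => hφ2c τ hτ i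
  have hC : ∀ τ ∈ Icc 0 T, Integrable fun x => h' (W τ x) * W τ x * lapR (φ τ) x := by
    intro τ hτ
    refine ((hWi τ hτ).norm.const_mul (L * (3 * Λ))).mono' (((hh'W τ hτ).mul
      (hWc τ hτ).continuous).mul (hlapc τ hτ)).aestronglyMeasurable ?_
    filter_upwards with x
    rw [norm_mul, norm_mul]
    have h1 := hh'L _ (hWM τ hτ x)
    have h2 := hlapb τ hτ x
    calc ‖h' (W τ x)‖ * ‖W τ x‖ * ‖lapR (φ τ) x‖
        ≤ L * ‖W τ x‖ * (3 * Λ) := by gcongr <;> assumption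
      _ = _ := by ring
  have hD : ∀ τ ∈ Icc 0 T, Integrable fun x => h' (W τ x) * G τ x := by
    intro τ hτ
    refine ((hGi τ hτ).norm.const_mul L).mono' ((hh'W τ hτ).aestronglyMeasurable.mul
      (hGi τ hτ).aestronglyMeasurable) ?_
    filter_upwards with x
    rw [norm_mul]
    exact mul_le_mul_of_nonneg_right (hh'L _ (hWM τ hτ x)) (norm_nonneg _)
  have hAs : ∀ τ ∈ Icc 0 T, Integrable fun x =>
      ∑ i : Fin 3, fderiv ℝ (fun y => h (W τ y)) x (e3 i) * pdR i (φ τ) x := fun τ hτ =>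
    integrable_finsetSum _ fun i _ => hA τ hτ i
  have hvi : ∀ τ ∈ Icc 0 T, Integrable fun x => derivWithin (fun τ => u τ x) (Icc 0 T) τ := by
    intro τ hτ
    simp only [hder τ hτ]
    exact (((((hAs τ hτ).neg).sub (hC τ hτ)).add (hD τ hτ)).sub
      ((hhi τ hτ).const_mul lam)).const_mul _
  have hexp : ∀ τ ∈ Icc 0 T, exp (-lam * τ) ≤ 1 := fun τ hτ =>
    exp_le_one_iff.2 (by nlinarith [hτ.1])
  have hvN : ∀ τ ∈ Icc 0 T, ∫ x, ‖derivWithin (fun τ => u τ x) (Icc 0 T) τ‖ ≤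
      ∑ _i : Fin 3, L * Λ * N + L * (3 * Λ) * N + L * N + lam * L * N := by
    intro τ hτ
    have hi1 : Integrable fun x => ∑ i : Fin 3, L * Λ * |pdR i (W τ) x| :=
      integrable_finsetSum _ fun i _ => (hdi τ hτ i).abs.const_mul _
    have hi2 := (hWi τ hτ).abs.const_mul (L * (3 * Λ))
    have hi3 := (hGi τ hτ).abs.const_mul L
    have hi4 := (hWi τ hτ).abs.const_mul (lam * L)
    have hi12 : Integrable fun x => (∑ i : Fin 3, L * Λ * |pdR i (W τ) x|) +
      L * (3 * Λ) * |W τ x| := hi1.add hi2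
    have hi123 : Integrable fun x => (∑ i : Fin 3, L * Λ * |pdR i (W τ) x|) +
      L * (3 * Λ) * |W τ x| + L * |G τ x| := hi12.add hi3
    calc ∫ x, ‖derivWithin (fun τ => u τ x) (Icc 0 T) τ‖
        ≤ ∫ x, ((((∑ i : Fin 3, L * Λ * |pdR i (W τ) x|) + L * (3 * Λ) * |W τ x|)
          + L * |G τ x|) + lam * L * |W τ x|) := by
          refine integral_mono (hvi τ hτ).norm (hi123.add hi4) fun x => ?_
          simp only [hder τ hτ, hfd τ hτ]
          rw [norm_mul, Real.norm_of_nonneg (exp_pos _).le]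
          refine (mul_le_of_le_one_left (norm_nonneg _) (hexp τ hτ)).trans ?_
          have hw := hWM τ hτ x
          have h1 := hh'L _ hw
          refine (norm_sub_le _ _).trans (add_le_add ((norm_add_le _ _).trans
            (add_le_add ((norm_sub_le _ _).trans (add_le_add ?_ ?_)) ?_)) ?_)
          · rw [norm_neg]
            refine (norm_sum_le _ _).trans (Finset.sum_le_sum fun i _ => ?_)
            rw [norm_mul, norm_mul]
            have h2 := hφ1 τ hτ i x
            calc ‖h' (W τ x)‖ * ‖pdR i (W τ) x‖ * ‖pdR i (φ τ) x‖
                ≤ L * ‖pdR i (W τ) x‖ * Λ := by gcongr <;> assumption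
              _ = _ := by rw [Real.norm_eq_abs]; ring
          · rw [norm_mul, norm_mul]
            have h2 := hlapb τ hτ x
            calc ‖h' (W τ x)‖ * ‖W τ x‖ * ‖lapR (φ τ) x‖
                ≤ L * ‖W τ x‖ * (3 * Λ) := by gcongr <;> assumption
              _ = _ := by rw [Real.norm_eq_abs]; ring
          · rw [norm_mul]
            exact mul_le_mul_of_nonneg_right h1 (norm_nonneg _)
          · rw [norm_mul, Real.norm_of_nonneg hlam0.le, Real.norm_of_nonneg (hpos _), mul_assoc]
            exact mul_le_mul_of_nonneg_left (hhL _ hw) hlam0.le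
      _ = (∑ i : Fin 3, L * Λ * ∫ x, |pdR i (W τ) x|) + L * (3 * Λ) * (∫ x, |W τ x|)
          + L * (∫ x, |G τ x|) + lam * L * ∫ x, |W τ x| := by
          rw [integral_add hi123 hi4, integral_add hi12 hi3,
            integral_add hi1 hi2, integral_finsetSum _ fun i _ => (hdi τ hτ i).abs.const_mul _]
          simp only [integral_const_mul]
      _ ≤ _ := by
          have h1 := hWN τ hτ
          have h2 := hdN τ hτ
          have h3 := hGN τ hτ
          gcongr with i
          exact h2 i
  have hdecay : ∀ τ ∈ Icc 0 T, ∫ x, derivWithin (fun τ => u τ x) (Icc 0 T) τ ≤ E₀ := by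
    intro τ hτ
    have hibp : ∀ i : Fin 3, ∫ x, fderiv ℝ (fun y => h (W τ y)) x (e3 i) * pdR i (φ τ) x =
        -∫ x, h (W τ x) * pdR i (pdR i (φ τ)) x := by
      intro i
      have hfg : Integrable fun x => h (W τ x) * pdR i (φ τ) x := by
        refine ((hhi τ hτ).const_mul Λ).mono' ((hh.continuous.comp (hWc τ hτ).continuous).mul
          (hφ1c τ hτ i).continuous).aestronglyMeasurable ?_
        filter_upwards with x
        rw [norm_mul, Real.norm_of_nonneg (hpos _), mul_comm]
        exact mul_le_mul_of_nonneg_right (hφ1 τ hτ i x) (hpos _)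
      rw [eq_neg_iff_add_eq_zero, add_comm, ← eq_neg_iff_add_eq_zero]
      exact integral_mul_fderiv_eq_neg_fderiv_mul_of_integrable (hA τ hτ i) (hB τ hτ i) hfg
        (fun x _ => (hd _).differentiableAt.comp x
          ((hWc τ hτ).differentiable one_ne_zero x))
        (fun x _ => (hφ1c τ hτ i).differentiable one_ne_zero x)
    have hBs : Integrable fun x => h (W τ x) * lapR (φ τ) x := by
      simp only [lapR, Finset.mul_sum]
      exact integrable_finsetSum _ fun i _ => hB τ hτ i
    have hsum : ∫ x, ∑ i : Fin 3, fderiv ℝ (fun y => h (W τ y)) x (e3 i) * pdR i (φ τ) x =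
        -∫ x, h (W τ x) * lapR (φ τ) x := by
      rw [integral_finsetSum _ fun i _ => hA τ hτ i]
      simp only [lapR, Finset.mul_sum, hibp]
      rw [integral_finsetSum _ fun i _ => hB τ hτ i, Finset.sum_neg_distrib]
    have hi := hhi τ hτ
    simp only [hder τ hτ]
    have hswap : ∫ x, (-(∑ i : Fin 3, fderiv ℝ (fun y => h (W τ y)) x (e3 i) * pdR i (φ τ) x) -
        h' (W τ x) * W τ x * lapR (φ τ) x + h' (W τ x) * G τ x - lam * h (W τ x)) =
        ∫ x, (h (W τ x) * lapR (φ τ) x - h' (W τ x) * W τ x * lapR (φ τ) x +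
        h' (W τ x) * G τ x - lam * h (W τ x)) := by
      have hneg : Integrable fun x =>
          -∑ i : Fin 3, fderiv ℝ (fun y => h (W τ y)) x (e3 i) * pdR i (φ τ) x := (hAs τ hτ).neg
      have h1 := (((hneg.sub (hC τ hτ)).add (hD τ hτ)).sub (hi.const_mul lam))
      have h2 := (((hBs.sub (hC τ hτ)).add (hD τ hτ)).sub (hi.const_mul lam))
      rw [← sub_eq_zero]
      refine (integral_sub h1 h2).symm.trans ?_
      trans ∫ x, (-(∑ i : Fin 3, fderiv ℝ (fun y => h (W τ y)) x (e3 i) * pdR i (φ τ) x) -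
        h (W τ x) * lapR (φ τ) x)
      · congr 1
        funext x
        simp only [Pi.add_apply, Pi.sub_apply]
        ring
      · rw [integral_sub hneg hBs, integral_neg, hsum]
        ring
    rw [integral_const_mul, hswap]
    have hle : ∫ x, (h (W τ x) * lapR (φ τ) x - h' (W τ x) * W τ x * lapR (φ τ) x +
        h' (W τ x) * G τ x - lam * h (W τ x)) ≤ ∫ x, E τ x := by
      refine integral_mono (((hBs.sub (hC τ hτ)).add (hD τ hτ)).sub (hi.const_mul lam))
        (hEi τ hτ) fun x => ?_
      have h1 : (h (W τ x) - h' (W τ x) * W τ x) * lapR (φ τ) x ≤ h (W τ x) * (3 * Λ) := by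
        refine (le_abs_self _).trans ?_
        rw [abs_mul]
        exact mul_le_mul (hconv _) (hlapb τ hτ x) (abs_nonneg _) (hpos _)
      have h2 := (le_abs_self _).trans (hGE τ hτ x)
      simp only [hlam]
      nlinarith
    calc _ ≤ exp (-lam * τ) * E₀ :=
          mul_le_mul_of_nonneg_left (hle.trans (hE τ hτ)) (exp_pos _).le
      _ ≤ E₀ := mul_le_of_le_one_left hE₀ (hexp τ hτ)
  have hmain := integral_sub_eq_integral_derivWithin hT hu
    (fun τ hτ => (hhi τ hτ).const_mul _) hvi hvN ht
  have hbound : ∫ τ in Ioc 0 t, ∫ x, derivWithin (fun τ => u τ x) (Icc 0 T) τ ≤ T * E₀ := by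
    by_cases hI : IntegrableOn (fun τ => ∫ x, derivWithin (fun τ => u τ x) (Icc 0 T) τ) (Ioc 0 t)
    · calc ∫ τ in Ioc 0 t, ∫ x, derivWithin (fun τ => u τ x) (Icc 0 T) τ
          ≤ ∫ _τ in Ioc 0 t, E₀ := setIntegral_mono_on hI (integrable_const _) measurableSet_Ioc
            fun τ hτ => hdecay τ ⟨hτ.1.le, hτ.2.trans ht.2⟩
        _ = t * E₀ := by simp [ht.1]
        _ ≤ T * E₀ := mul_le_mul_of_nonneg_right ht.2 hE₀
    · rw [integral_undef hI]
      positivity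
  simp only [hu_def, integral_const_mul, mul_zero, exp_zero, one_mul] at hmain
  have hfin : exp (-lam * t) * ∫ x, h (W t x) ≤ (∫ x, h (W 0 x)) + T * E₀ := by linarith
  have hR : 0 ≤ (∫ x, h (W 0 x)) + T * E₀ :=
    add_nonneg (integral_nonneg fun x => hpos _) (by positivity)
  calc ∫ x, h (W t x) = exp (lam * t) * (exp (-lam * t) * ∫ x, h (W t x)) := by
        rw [← mul_assoc, ← exp_add]; simp
    _ ≤ exp (lam * t) * ((∫ x, h (W 0 x)) + T * E₀) :=
        mul_le_mul_of_nonneg_left hfin (exp_pos _).le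
    _ ≤ exp (lam * T) * ((∫ x, h (W 0 x)) + T * E₀) :=
        mul_le_mul_of_nonneg_right (exp_le_exp.2 (by nlinarith [ht.2])) hR

theorem integral_mpd_le {s : ℕ} {σ : Fin 3 → ℕ} (hσ : mdeg σ ≤ s) (g : E3 → ℂ) :
    ∫ x, ‖mpd σ g x‖ ^ 2 ≤ sobNorm s g ^ 2 := by
  have hmem : σ ∈ mIdx s := by
    simp only [mIdx, Finset.mem_filter, Fintype.mem_piFinset, Finset.mem_range]
    refine ⟨fun i => ?_, hσ⟩
    simp only [mdeg] at hσ
    fin_cases i <;> simp <;> omega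
  have h0 : ∀ σ : Fin 3 → ℕ, 0 ≤ ∫ x, ‖mpd σ g x‖ ^ 2 := fun σ =>
    integral_nonneg fun x => by positivity
  rw [sobNorm, Real.sq_sqrt (Finset.sum_nonneg fun σ _ => h0 σ)]
  exact Finset.single_le_sum (f := fun σ => ∫ x, ‖mpd σ g x‖ ^ 2) (fun σ _ => h0 σ) hmem

theorem mdeg_single (i : Fin 3) (k : ℕ) : mdeg (Pi.single i k) = k := by
  fin_cases i <;> simp [mdeg]

theorem mpd_single_one (i : Fin 3) (g : E3 → ℂ) : mpd (Pi.single i 1) g = pd i g := by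
  fin_cases i <;> simp [mpd]

theorem mpd_single_two (i : Fin 3) (g : E3 → ℂ) : mpd (Pi.single i 2) g = pd i (pd i g) := by
  fin_cases i <;> simp [mpd]

theorem mpdR_single_one (i : Fin 3) (g : E3 → ℝ) : mpdR (Pi.single i 1) g = pdR i g := by
  fin_cases i <;> simp [mpdR]

theorem mpdR_single_two (i : Fin 3) (g : E3 → ℝ) :
    mpdR (Pi.single i 2) g = pdR i (pdR i g) := by
  fin_cases i <;> simp [mpdR]

/-- A `C²` function bounded by `M` whose `L²` norm and first and unmixed second partial
derivatives have `L²` norm at most `B`. -/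
structure SobolevBounds (M B : ℝ) (u : E3 → ℂ) : Prop where
  contDiff : ContDiff ℝ 2 u
  norm_le : ∀ x, ‖u x‖ ≤ M
  integrable_sq : Integrable fun x => ‖u x‖ ^ 2
  integral_sq_le : ∫ x, ‖u x‖ ^ 2 ≤ B ^ 2
  integrable_pd_sq : ∀ i, Integrable fun x => ‖pd i u x‖ ^ 2
  integral_pd_sq_le : ∀ i, ∫ x, ‖pd i u x‖ ^ 2 ≤ B ^ 2
  integrable_pd_pd_sq : ∀ i, Integrable fun x => ‖pd i (pd i u) x‖ ^ 2
  integral_pd_pd_sq_le : ∀ i, ∫ x, ‖pd i (pd i u) x‖ ^ 2 ≤ B ^ 2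

theorem exists_sobolevBounds (B : ℝ) :
    ∃ M : ℝ, 1 ≤ M ∧ ∀ s : ℕ, 2 ≤ s → ∀ u : E3 → ℂ, IsSchwartzF u → sobNorm s u ≤ B →
      SobolevBounds M B u := by
  obtain ⟨C₀, hC₀⟩ := exists_sobolev_sup_bound
  refine ⟨max 1 (C₀ + 2 * (B ^ 2 + 3 * B ^ 2)), le_max_left _ _, fun s hs u hu hB => ?_⟩
  have hsq : sobNorm s u ^ 2 ≤ B ^ 2 := pow_le_pow_left₀ (Real.sqrt_nonneg _) hB 2
  have hu2 : ContDiff ℝ 2 u := hu.1 2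
  have hL2 : ∀ g : 𝓢(E3, ℂ), Integrable fun ξ => ‖g ξ‖ ^ 2 := fun g =>
    (g.memLp 2).integrable_norm_pow (by norm_num)
  have h0 : ∫ x, ‖u x‖ ^ 2 ≤ B ^ 2 :=
    (integral_mpd_le (s := s) (σ := 0) (by simp [mdeg]) u).trans hsq
  have h1 : ∀ i, ∫ x, ‖pd i u x‖ ^ 2 ≤ B ^ 2 := fun i => by
    rw [← mpd_single_one]
    exact (integral_mpd_le (s := s) (by rw [mdeg_single]; omega) u).trans hsq
  have h2 : ∀ i, ∫ x, ‖pd i (pd i u) x‖ ^ 2 ≤ B ^ 2 := fun i => by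
    rw [← mpd_single_two]
    exact (integral_mpd_le (s := s) (by rw [mdeg_single]; omega) u).trans hsq
  obtain ⟨f, rfl⟩ := hu.exists_schwartzMap
  refine ⟨hu2, fun x => ?_, hL2 f, h0, fun i => ?_, h1, fun i => ?_, h2⟩
  · refine (hC₀ f x).trans (le_trans ?_ (le_max_right _ _))
    have h3 : ∑ i : Fin 3, ∫ y, ‖pd i (pd i ⇑f) y‖ ^ 2 ≤ 3 * B ^ 2 := by
      refine (Finset.sum_le_sum fun i _ => h2 i).trans ?_
      simp
    linarith
  · rw [pd_schwartzMap]; exact hL2 _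
  · rw [pd_schwartzMap, pd_schwartzMap]; exact hL2 _

theorem continuous_pd {u : E3 → ℂ} (hu : ContDiff ℝ 1 u) (i : Fin 3) : Continuous (pd i u) :=
  (hu.continuous_fderiv one_ne_zero).clm_apply continuous_const

theorem continuous_lapC {u : E3 → ℂ} (hu : ContDiff ℝ 2 u) : Continuous (lapC u) := by
  refine continuous_finsetSum _ fun i _ => continuous_pd ?_ i
  exact (hu.fderiv_right (m := 1) (by norm_num)).clm_apply contDiff_const

theorem pdR_norm_sq {u : E3 → ℂ} {x : E3} (hu : DifferentiableAt ℝ u x) (i : Fin 3) :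
    pdR i (fun y => ‖u y‖ ^ 2) x = 2 * ((starRingEnd ℂ) (u x) * pd i u x).re := by
  rw [pdR, hu.hasFDerivAt.norm_sq.fderiv]
  simp [pd, Complex.inner]
  ring

theorem derivWithin_norm_sq {u : ℝ → ℂ} {S : Set ℝ} {t : ℝ} (hu : DifferentiableWithinAt ℝ u S t)
    (hS : UniqueDiffWithinAt ℝ S t) :
    derivWithin (fun τ => ‖u τ‖ ^ 2) S t =
      2 * ((starRingEnd ℂ) (u t) * derivWithin u S t).re := by
  rw [hu.hasDerivWithinAt.norm_sq.derivWithin hS]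
  simp [Complex.inner]
  ring

theorem two_mul_re_of_amplitude_eq {u w L : ℂ} {b : Fin 3 → ℝ} {v : Fin 3 → ℂ} {l e c : ℝ}
    (h : w + (∑ i : Fin 3, (b i : ℂ) * v i) + (1 / 2 : ℂ) * u * (l : ℂ) =
      Complex.I * ((e : ℂ) / 2) * L - Complex.I * (c : ℂ) * u) :
    2 * ((starRingEnd ℂ) u * w).re =
      -(∑ i : Fin 3, b i * (2 * ((starRingEnd ℂ) u * v i).re)) - ‖u‖ ^ 2 * l -
        e * ((starRingEnd ℂ) u * L).im := by
  have hw : w = Complex.I * ((e : ℂ) / 2) * L - Complex.I * (c : ℂ) * u -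
      (∑ i : Fin 3, (b i : ℂ) * v i) - (1 / 2 : ℂ) * u * (l : ℂ) := by
    rw [← h]; ring
  rw [hw, ← Complex.normSq_eq_norm_sq, Complex.normSq_apply]
  simp [Fin.sum_univ_three]
  ring

theorem derivWithin_density {T e c t : ℝ} (hT : 0 < T) {u : ℝ → E3 → ℂ} {φ : ℝ → E3 → ℝ}
    (hu : ContDiffOn ℝ 1 (fun q : ℝ × E3 => u q.1 q.2) (Icc 0 T ×ˢ univ)) (ht : t ∈ Icc 0 T)
    {x : E3}
    (h : derivWithin (fun τ => u τ x) (Icc 0 T) t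
        + (∑ i : Fin 3, (pdR i (φ t) x : ℂ) * pd i (u t) x)
        + (1 / 2 : ℂ) * u t x * (lapR (φ t) x : ℂ)
      = Complex.I * ((e : ℂ) / 2) * lapC (u t) x - Complex.I * (c : ℂ) * u t x) :
    derivWithin (fun τ => ‖u τ x‖ ^ 2) (Icc 0 T) t =
      -(∑ i : Fin 3, pdR i (φ t) x * pdR i (fun y => ‖u t y‖ ^ 2) x) -
        ‖u t x‖ ^ 2 * lapR (φ t) x -
        e * ((starRingEnd ℂ) (u t x) * lapC (u t) x).im := by
  rw [derivWithin_norm_sq (hasDerivWithinAt_slice hu ht x).differentiableWithinAt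
    (uniqueDiffOn_Icc hT t ht), two_mul_re_of_amplitude_eq h]
  simp only [pdR_norm_sq ((contDiff_slice hu ht).differentiable one_ne_zero x)]

namespace SobolevBounds

variable {M B : ℝ} {u v : E3 → ℂ}

theorem contDiff_norm_sq (hu : SobolevBounds M B u) : ContDiff ℝ 2 fun x => ‖u x‖ ^ 2 :=
  hu.contDiff.norm_sq ℝ

theorem differentiable_norm_sq (hu : SobolevBounds M B u) :
    Differentiable ℝ fun x => ‖u x‖ ^ 2 :=
  hu.contDiff_norm_sq.differentiable two_ne_zero

theorem abs_pdR_norm_sq_le (hu : SobolevBounds M B u) (i : Fin 3) (x : E3) :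
    |pdR i (fun y => ‖u y‖ ^ 2) x| ≤ ‖u x‖ ^ 2 + ‖pd i u x‖ ^ 2 := by
  rw [pdR_norm_sq (hu.contDiff.differentiable two_ne_zero x), abs_mul, abs_two]
  have h := Complex.abs_re_le_norm ((starRingEnd ℂ) (u x) * pd i u x)
  rw [norm_mul, RCLike.norm_conj] at h
  nlinarith [two_mul_le_add_sq ‖u x‖ ‖pd i u x‖]

theorem integrable_pdR_norm_sq (hu : SobolevBounds M B u) (i : Fin 3) :
    Integrable (pdR i fun y => ‖u y‖ ^ 2) :=
  (hu.integrable_sq.add (hu.integrable_pd_sq i)).mono'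
    ((hu.contDiff_norm_sq.continuous_fderiv two_ne_zero).clm_apply
      continuous_const).aestronglyMeasurable
    (Filter.Eventually.of_forall (hu.abs_pdR_norm_sq_le i))

theorem integral_abs_pdR_norm_sq_le (hu : SobolevBounds M B u) (i : Fin 3) :
    ∫ x, |pdR i (fun y => ‖u y‖ ^ 2) x| ≤ 2 * B ^ 2 := by
  refine (integral_mono (hu.integrable_pdR_norm_sq i).abs
    (hu.integrable_sq.add (hu.integrable_pd_sq i)) (hu.abs_pdR_norm_sq_le i)).trans ?_
  have h := integral_add hu.integrable_sq (hu.integrable_pd_sq i)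
  have h1 := hu.integral_sq_le
  have h2 := hu.integral_pd_sq_le i
  simp only [Pi.add_apply]
  linarith

theorem integrable_norm_sq_sub (hu : SobolevBounds M B u) (hv : SobolevBounds M B v) :
    Integrable fun x => ‖u x‖ ^ 2 - ‖v x‖ ^ 2 :=
  hu.integrable_sq.sub hv.integrable_sq

theorem abs_norm_sq_sub_le (hu : SobolevBounds M B u) (hv : SobolevBounds M B v) (x : E3) :
    |‖u x‖ ^ 2 - ‖v x‖ ^ 2| ≤ M ^ 2 := by
  have h1 := pow_le_pow_left₀ (norm_nonneg _) (hu.norm_le x) 2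
  have h2 := pow_le_pow_left₀ (norm_nonneg _) (hv.norm_le x) 2
  rw [abs_le]
  constructor <;> nlinarith [sq_nonneg ‖u x‖, sq_nonneg ‖v x‖]

theorem integral_abs_norm_sq_sub_le (hu : SobolevBounds M B u) (hv : SobolevBounds M B v) :
    ∫ x, |‖u x‖ ^ 2 - ‖v x‖ ^ 2| ≤ 2 * B ^ 2 := by
  calc ∫ x, |‖u x‖ ^ 2 - ‖v x‖ ^ 2| ≤ ∫ x, (‖u x‖ ^ 2 + ‖v x‖ ^ 2) := by
        refine integral_mono (hu.integrable_norm_sq_sub hv).abs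
          (hu.integrable_sq.add hv.integrable_sq) fun x => ?_
        simp only
        rw [abs_le]
        constructor <;> nlinarith [sq_nonneg ‖u x‖, sq_nonneg ‖v x‖]
    _ = (∫ x, ‖u x‖ ^ 2) + ∫ x, ‖v x‖ ^ 2 := integral_add hu.integrable_sq hv.integrable_sq
    _ ≤ 2 * B ^ 2 := by linarith [hu.integral_sq_le, hv.integral_sq_le]

theorem pdR_norm_sq_sub (hu : SobolevBounds M B u) (hv : SobolevBounds M B v) (i : Fin 3) :
    (pdR i fun y => ‖u y‖ ^ 2 - ‖v y‖ ^ 2) =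
      fun x => pdR i (fun y => ‖u y‖ ^ 2) x - pdR i (fun y => ‖v y‖ ^ 2) x := by
  funext x
  simp only [pdR]
  rw [fderiv_fun_sub (hu.differentiable_norm_sq x) (hv.differentiable_norm_sq x)]
  rfl

theorem integrable_pdR_norm_sq_sub (hu : SobolevBounds M B u) (hv : SobolevBounds M B v)
    (i : Fin 3) : Integrable (pdR i fun y => ‖u y‖ ^ 2 - ‖v y‖ ^ 2) := by
  rw [hu.pdR_norm_sq_sub hv]
  exact (hu.integrable_pdR_norm_sq i).sub (hv.integrable_pdR_norm_sq i)

theorem integral_abs_pdR_norm_sq_sub_le (hu : SobolevBounds M B u) (hv : SobolevBounds M B v)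
    (i : Fin 3) : ∫ x, |pdR i (fun y => ‖u y‖ ^ 2 - ‖v y‖ ^ 2) x| ≤ 4 * B ^ 2 := by
  have h1 := (hu.integrable_pdR_norm_sq i).abs
  have h2 := (hv.integrable_pdR_norm_sq i).abs
  rw [hu.pdR_norm_sq_sub hv]
  refine (integral_mono ((hu.integrable_pdR_norm_sq i).sub (hv.integrable_pdR_norm_sq i)).abs
    (h1.add h2) fun x => abs_sub _ _).trans ?_
  have h := integral_add h1 h2
  simp only [Pi.add_apply]
  linarith [hu.integral_abs_pdR_norm_sq_le i, hv.integral_abs_pdR_norm_sq_le i]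

theorem continuous_im_conj_mul_lapC (hu : SobolevBounds M B u) :
    Continuous fun x => ((starRingEnd ℂ) (u x) * lapC u x).im :=
  Complex.continuous_im.comp
    ((Complex.continuous_conj.comp hu.contDiff.continuous).mul (continuous_lapC hu.contDiff))

theorem abs_im_conj_mul_lapC_le (x : E3) :
    |((starRingEnd ℂ) (u x) * lapC u x).im| ≤ ‖u x‖ * ∑ i : Fin 3, ‖pd i (pd i u) x‖ := by
  refine (Complex.abs_im_le_norm _).trans ?_
  rw [norm_mul, RCLike.norm_conj]
  exact mul_le_mul_of_nonneg_left (norm_sum_le _ _) (norm_nonneg _)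

theorem abs_im_conj_mul_lapC_le_sum (x : E3) :
    |((starRingEnd ℂ) (u x) * lapC u x).im| ≤
      ∑ i : Fin 3, (‖u x‖ ^ 2 + ‖pd i (pd i u) x‖ ^ 2) / 2 := by
  refine (abs_im_conj_mul_lapC_le x).trans ?_
  rw [Finset.mul_sum]
  refine Finset.sum_le_sum fun i _ => ?_
  linarith [two_mul_le_add_sq ‖u x‖ ‖pd i (pd i u) x‖]

theorem integrable_sum_add_div_two (hu : SobolevBounds M B u) :
    Integrable fun x => ∑ i : Fin 3, (‖u x‖ ^ 2 + ‖pd i (pd i u) x‖ ^ 2) / 2 :=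
  integrable_finsetSum _ fun i _ => (hu.integrable_sq.add (hu.integrable_pd_pd_sq i)).div_const 2

theorem integrable_im_conj_mul_lapC (hu : SobolevBounds M B u) :
    Integrable fun x => ((starRingEnd ℂ) (u x) * lapC u x).im :=
  hu.integrable_sum_add_div_two.mono' hu.continuous_im_conj_mul_lapC.aestronglyMeasurable
    (Filter.Eventually.of_forall abs_im_conj_mul_lapC_le_sum)

theorem integral_abs_im_conj_mul_lapC_le (hu : SobolevBounds M B u) :
    ∫ x, |((starRingEnd ℂ) (u x) * lapC u x).im| ≤ 3 * B ^ 2 := by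
  refine (integral_mono hu.integrable_im_conj_mul_lapC.abs hu.integrable_sum_add_div_two
    abs_im_conj_mul_lapC_le_sum).trans ?_
  have hi : ∀ i : Fin 3, Integrable fun x => (‖u x‖ ^ 2 + ‖pd i (pd i u) x‖ ^ 2) / 2 :=
    fun i => (hu.integrable_sq.add (hu.integrable_pd_pd_sq i)).div_const 2
  rw [integral_finsetSum _ fun i _ => hi i]
  have h : ∀ i : Fin 3, ∫ x, (‖u x‖ ^ 2 + ‖pd i (pd i u) x‖ ^ 2) / 2 ≤ B ^ 2 := fun i => by
    rw [integral_div, integral_add hu.integrable_sq (hu.integrable_pd_pd_sq i)]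
    linarith [hu.integral_sq_le, hu.integral_pd_pd_sq_le i]
  refine (Finset.sum_le_sum fun i _ => h i).trans ?_
  simp

theorem sq_im_conj_mul_lapC_le (hu : SobolevBounds M B u) (x : E3) :
    ((starRingEnd ℂ) (u x) * lapC u x).im ^ 2 ≤
      3 * M ^ 2 * ∑ i : Fin 3, ‖pd i (pd i u) x‖ ^ 2 := by
  rw [← sq_abs]
  have h1 := pow_le_pow_left₀ (abs_nonneg _) (abs_im_conj_mul_lapC_le (u := u) x) 2
  have h2 := pow_le_pow_left₀ (norm_nonneg _) (hu.norm_le x) 2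
  have h3 := sq_sum_le_card_mul_sum_sq (s := Finset.univ)
    (f := fun i : Fin 3 => ‖pd i (pd i u) x‖)
  simp only [Finset.card_univ, Fintype.card_fin, Nat.cast_ofNat] at h3
  calc _ ≤ ‖u x‖ ^ 2 * (∑ i : Fin 3, ‖pd i (pd i u) x‖) ^ 2 := by rw [← mul_pow]; exact h1
    _ ≤ M ^ 2 * (3 * ∑ i : Fin 3, ‖pd i (pd i u) x‖ ^ 2) :=
      mul_le_mul h2 h3 (sq_nonneg _) (sq_nonneg _)
    _ = _ := by ring

theorem integrable_sum_pd_pd_sq (hu : SobolevBounds M B u) :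
    Integrable fun x => ∑ i : Fin 3, ‖pd i (pd i u) x‖ ^ 2 :=
  integrable_finsetSum _ fun i _ => hu.integrable_pd_pd_sq i

theorem integrable_sq_im_conj_mul_lapC (hu : SobolevBounds M B u) :
    Integrable fun x => ((starRingEnd ℂ) (u x) * lapC u x).im ^ 2 := by
  refine (hu.integrable_sum_pd_pd_sq.const_mul (3 * M ^ 2)).mono'
    (hu.continuous_im_conj_mul_lapC.pow 2).aestronglyMeasurable
    (Filter.Eventually.of_forall fun x => ?_)
  rw [Real.norm_of_nonneg (sq_nonneg _)]
  exact hu.sq_im_conj_mul_lapC_le x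

theorem integral_sq_im_conj_mul_lapC_le (hu : SobolevBounds M B u) :
    ∫ x, ((starRingEnd ℂ) (u x) * lapC u x).im ^ 2 ≤ 9 * M ^ 2 * B ^ 2 := by
  refine (integral_mono hu.integrable_sq_im_conj_mul_lapC
    (hu.integrable_sum_pd_pd_sq.const_mul (3 * M ^ 2)) hu.sq_im_conj_mul_lapC_le).trans ?_
  rw [integral_const_mul, integral_finsetSum _ fun i _ => hu.integrable_pd_pd_sq i]
  have h := Finset.sum_le_sum fun i (_ : i ∈ Finset.univ) => hu.integral_pd_pd_sq_le i
  simp only [Finset.sum_const, Finset.card_univ, Fintype.card_fin, nsmul_eq_mul,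
    Nat.cast_ofNat] at h
  calc _ ≤ 3 * M ^ 2 * (3 * B ^ 2) := mul_le_mul_of_nonneg_left h (by positivity)
    _ = _ := by ring

theorem integrable_norm_sub_sq (hu : SobolevBounds M B u) (hv : SobolevBounds M B v) :
    Integrable fun x => ‖u x - v x‖ ^ 2 := by
  refine ((hu.integrable_sq.add hv.integrable_sq).const_mul 2).mono'
    ((hu.contDiff.continuous.sub hv.contDiff.continuous).norm.pow 2).aestronglyMeasurable
    (Filter.Eventually.of_forall fun x => ?_)
  rw [Real.norm_of_nonneg (sq_nonneg _)]
  simp only [Pi.add_apply]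
  have h := pow_le_pow_left₀ (norm_nonneg _) (norm_sub_le (u x) (v x)) 2
  nlinarith [two_mul_le_add_sq ‖u x‖ ‖v x‖]

theorem abs_norm_sq_sub_le_mul (a b : ℂ) : |‖a‖ ^ 2 - ‖b‖ ^ 2| ≤ ‖a - b‖ * (‖a‖ + ‖b‖) := by
  rw [sq_sub_sq, abs_mul, mul_comm, abs_of_nonneg (a := ‖a‖ + ‖b‖) (by positivity)]
  exact mul_le_mul_of_nonneg_right (abs_norm_sub_norm_le a b) (by positivity)

theorem integral_abs_norm_sq_sub_le_of_integral_norm_sub_sq_le (hu : SobolevBounds M B u)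
    (hv : SobolevBounds M B v) {D : ℝ} (hD : 0 < D) (hd : ∫ x, ‖u x - v x‖ ^ 2 ≤ D ^ 2) :
    ∫ x, |‖u x‖ ^ 2 - ‖v x‖ ^ 2| ≤ (1 + 4 * B ^ 2) / 2 * D := by
  have h1 := (hu.integrable_norm_sub_sq hv).const_mul (D⁻¹ / 2)
  have h2 : Integrable fun x => D * (‖u x‖ ^ 2 + ‖v x‖ ^ 2) :=
    (hu.integrable_sq.add hv.integrable_sq).const_mul D
  calc ∫ x, |‖u x‖ ^ 2 - ‖v x‖ ^ 2|
      ≤ ∫ x, (D⁻¹ / 2 * ‖u x - v x‖ ^ 2 + D * (‖u x‖ ^ 2 + ‖v x‖ ^ 2)) := by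
        refine integral_mono (hu.integrable_norm_sq_sub hv).abs (h1.add h2) fun x => ?_
        refine (abs_norm_sq_sub_le_mul _ _).trans ?_
        set d := ‖u x - v x‖
        set m := ‖u x‖ + ‖v x‖ with hm
        have h3 : d * m = 2⁻¹ * (2 * (D⁻¹ * d) * m) * D := by field_simp
        have h4 := two_mul_le_add_sq (D⁻¹ * d) m
        have h5 : m ^ 2 ≤ 2 * (‖u x‖ ^ 2 + ‖v x‖ ^ 2) := by
          nlinarith [two_mul_le_add_sq ‖u x‖ ‖v x‖]
        calc d * m = 2⁻¹ * (2 * (D⁻¹ * d) * m) * D := h3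
          _ ≤ 2⁻¹ * ((D⁻¹ * d) ^ 2 + 2 * (‖u x‖ ^ 2 + ‖v x‖ ^ 2)) * D := by
            gcongr
            linarith
          _ = _ := by field_simp
    _ = D⁻¹ / 2 * (∫ x, ‖u x - v x‖ ^ 2) +
          D * ((∫ x, ‖u x‖ ^ 2) + ∫ x, ‖v x‖ ^ 2) := by
        rw [integral_add h1 h2, integral_const_mul, integral_const_mul,
          integral_add hu.integrable_sq hv.integrable_sq]
    _ ≤ D⁻¹ / 2 * D ^ 2 + D * (B ^ 2 + B ^ 2) := by
        gcongr
        exacts [hu.integral_sq_le, hv.integral_sq_le]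
    _ = (1 + 4 * B ^ 2) / 2 * D := by field_simp; ring

theorem integrable_sq_norm_sq_sub (hu : SobolevBounds M B u) (hv : SobolevBounds M B v) :
    Integrable fun x => (‖u x‖ ^ 2 - ‖v x‖ ^ 2) ^ 2 := by
  refine ((hu.integrable_norm_sq_sub hv).abs.const_mul (M ^ 2)).mono'
    ((hu.contDiff_norm_sq.continuous.sub
      hv.contDiff_norm_sq.continuous).pow 2).aestronglyMeasurable
    (Filter.Eventually.of_forall fun x => ?_)
  rw [Real.norm_of_nonneg (sq_nonneg _), ← sq_abs, sq]
  exact mul_le_mul_of_nonneg_right (hu.abs_norm_sq_sub_le hv x) (abs_nonneg _)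

theorem integral_sq_norm_sq_sub_le_of_integral_norm_sub_sq_le (hu : SobolevBounds M B u)
    (hv : SobolevBounds M B v) {D : ℝ} (hd : ∫ x, ‖u x - v x‖ ^ 2 ≤ D ^ 2) :
    ∫ x, (‖u x‖ ^ 2 - ‖v x‖ ^ 2) ^ 2 ≤ 4 * M ^ 2 * D ^ 2 := by
  calc ∫ x, (‖u x‖ ^ 2 - ‖v x‖ ^ 2) ^ 2 ≤ ∫ x, 4 * M ^ 2 * ‖u x - v x‖ ^ 2 := by
        refine integral_mono (hu.integrable_sq_norm_sq_sub hv)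
          ((hu.integrable_norm_sub_sq hv).const_mul _) fun x => ?_
        simp only
        rw [← sq_abs]
        refine (pow_le_pow_left₀ (abs_nonneg _) (abs_norm_sq_sub_le_mul _ _) 2).trans ?_
        have h : ‖u x‖ + ‖v x‖ ≤ 2 * M := by linarith [hu.norm_le x, hv.norm_le x]
        calc (‖u x - v x‖ * (‖u x‖ + ‖v x‖)) ^ 2 ≤ (‖u x - v x‖ * (2 * M)) ^ 2 := by gcongr
          _ = _ := by ring
    _ ≤ 4 * M ^ 2 * D ^ 2 := by
        rw [integral_const_mul]
        gcongr

end SobolevBounds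

theorem hasDerivAt_sqrt_sq_add_sq {δ : ℝ} (hδ : 0 < δ) (w : ℝ) :
    HasDerivAt (fun w => √(w ^ 2 + δ ^ 2) - δ) (w / √(w ^ 2 + δ ^ 2)) w := by
  have h0 : w ^ 2 + δ ^ 2 ≠ 0 := by positivity
  have h := ((((hasDerivAt_id w).pow 2).add_const (δ ^ 2)).sqrt (by simpa using h0)).sub_const δ
  refine h.congr_deriv ?_
  simp
  field_simp

theorem contDiff_sqrt_sq_add_sq {δ : ℝ} (hδ : 0 < δ) :
    ContDiff ℝ 1 fun w : ℝ => √(w ^ 2 + δ ^ 2) - δ :=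
  (((contDiff_id.pow 2).add contDiff_const).sqrt fun w => by
    have : 0 < w ^ 2 + δ ^ 2 := by positivity
    exact this.ne').sub contDiff_const

theorem abs_le_sqrt_sq_add_sq (w δ : ℝ) : |w| ≤ √(w ^ 2 + δ ^ 2) :=
  Real.abs_le_sqrt (by nlinarith [sq_nonneg δ])

theorem le_sqrt_sq_add_sq (w δ : ℝ) : δ ≤ √(w ^ 2 + δ ^ 2) :=
  Real.le_sqrt_of_sq_le (by nlinarith [sq_nonneg w])

theorem sqrt_sq_add_sq_sub_le {w δ : ℝ} (hδ : 0 < δ) : √(w ^ 2 + δ ^ 2) - δ ≤ |w| := by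
  rw [sub_le_iff_le_add]
  refine Real.sqrt_le_iff.2 ⟨by positivity, ?_⟩
  nlinarith [abs_nonneg w, sq_abs w]

theorem abs_div_sqrt_sq_add_sq_le_one {w δ : ℝ} (hδ : 0 < δ) :
    |w / √(w ^ 2 + δ ^ 2)| ≤ 1 := by
  have hS : 0 < √(w ^ 2 + δ ^ 2) := by positivity
  rw [abs_div, abs_of_pos hS, div_le_one hS]
  exact abs_le_sqrt_sq_add_sq w δ

theorem abs_sqrt_sq_add_sq_sub_le {w δ : ℝ} (hδ : 0 < δ) :
    |√(w ^ 2 + δ ^ 2) - δ - w / √(w ^ 2 + δ ^ 2) * w| ≤ √(w ^ 2 + δ ^ 2) - δ := by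
  have hS : 0 < √(w ^ 2 + δ ^ 2) := by positivity
  have hsq : √(w ^ 2 + δ ^ 2) ^ 2 = w ^ 2 + δ ^ 2 := Real.sq_sqrt (by positivity)
  have hle := le_sqrt_sq_add_sq w δ
  set S := √(w ^ 2 + δ ^ 2)
  have h1 : S - δ - w / S * w = -(δ / S * (S - δ)) := by
    field_simp
    linarith
  rw [h1, abs_neg, abs_of_nonneg (mul_nonneg (by positivity) (by linarith))]
  exact mul_le_of_le_one_left (by linarith) ((div_le_one hS).2 hle)

theorem density_difference_estimate {T Λ M B ε D : ℝ} (hT : 0 < T) (hΛ : 0 ≤ Λ)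
    (hε : 0 < ε) (hεD : ε ≤ D) {u v : ℝ → E3 → ℂ} {φ c k : ℝ → E3 → ℝ}
    (hu : ContDiffOn ℝ 1 (fun q : ℝ × E3 => u q.1 q.2) (Icc 0 T ×ˢ univ))
    (hv : ContDiffOn ℝ 1 (fun q : ℝ × E3 => v q.1 q.2) (Icc 0 T ×ˢ univ))
    (hub : ∀ t ∈ Icc 0 T, SobolevBounds M B (u t))
    (hvb : ∀ t ∈ Icc 0 T, SobolevBounds M B (v t))
    (hφ : ∀ t ∈ Icc 0 T, ContDiff ℝ 2 (φ t))
    (hφ1 : ∀ t ∈ Icc 0 T, ∀ i x, |pdR i (φ t) x| ≤ Λ)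
    (hφ2 : ∀ t ∈ Icc 0 T, ∀ i x, |pdR i (pdR i (φ t)) x| ≤ Λ)
    (hueq : ∀ t ∈ Icc 0 T, ∀ x, derivWithin (fun τ => u τ x) (Icc 0 T) t
        + (∑ i : Fin 3, (pdR i (φ t) x : ℂ) * pd i (u t) x)
        + (1 / 2 : ℂ) * u t x * (lapR (φ t) x : ℂ)
      = Complex.I * ((ε : ℂ) / 2) * lapC (u t) x - Complex.I * (c t x : ℂ) * u t x)
    (hveq : ∀ t ∈ Icc 0 T, ∀ x, derivWithin (fun τ => v τ x) (Icc 0 T) t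
        + (∑ i : Fin 3, (pdR i (φ t) x : ℂ) * pd i (v t) x)
        + (1 / 2 : ℂ) * v t x * (lapR (φ t) x : ℂ)
      = -Complex.I * (k t x : ℂ) * v t x)
    (h0 : ∫ x, ‖u 0 x - v 0 x‖ ^ 2 ≤ D ^ 2) {t : ℝ} (ht : t ∈ Icc 0 T) :
    (∫ x, |‖u t x‖ ^ 2 - ‖v t x‖ ^ 2| ≤
      exp ((3 * Λ + 1) * T) * ((1 + 4 * B ^ 2) / 2 + T * (3 * B ^ 2)) * D) ∧
    ∫ x, (‖u t x‖ ^ 2 - ‖v t x‖ ^ 2) ^ 2 ≤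
      exp ((3 * Λ + 1) * T) * (4 * M ^ 2 + T * (9 * M ^ 2 * B ^ 2)) * D ^ 2 := by
  have hD : 0 < D := hε.trans_le hεD
  have hT0 : (0 : ℝ) ∈ Icc 0 T := ⟨le_rfl, hT.le⟩
  set W : ℝ → E3 → ℝ := fun t x => ‖u t x‖ ^ 2 - ‖v t x‖ ^ 2 with hWdef
  set G : ℝ → E3 → ℝ := fun t x => -(ε * ((starRingEnd ℂ) (u t x) * lapC (u t) x).im) with hGdef
  have hW : ContDiffOn ℝ 1 (fun q : ℝ × E3 => W q.1 q.2) (Icc 0 T ×ˢ univ) :=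
    (hu.norm_sq ℝ).sub (hv.norm_sq ℝ)
  have hWi : ∀ t ∈ Icc 0 T, Integrable (W t) := fun t ht =>
    (hub t ht).integrable_norm_sq_sub (hvb t ht)
  have hWM : ∀ t ∈ Icc 0 T, ∀ x, |W t x| ≤ M ^ 2 := fun t ht x =>
    (hub t ht).abs_norm_sq_sub_le (hvb t ht) x
  have hB2 : 0 ≤ B ^ 2 := sq_nonneg B
  have hWN : ∀ t ∈ Icc 0 T, ∫ x, |W t x| ≤ (4 + 3 * ε) * B ^ 2 := fun t ht =>
    ((hub t ht).integral_abs_norm_sq_sub_le (hvb t ht)).trans (by nlinarith)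
  have hdi : ∀ t ∈ Icc 0 T, ∀ i, Integrable (pdR i (W t)) := fun t ht i =>
    (hub t ht).integrable_pdR_norm_sq_sub (hvb t ht) i
  have hdN : ∀ t ∈ Icc 0 T, ∀ i, ∫ x, |pdR i (W t) x| ≤ (4 + 3 * ε) * B ^ 2 := fun t ht i =>
    ((hub t ht).integral_abs_pdR_norm_sq_sub_le (hvb t ht) i).trans (by nlinarith)
  have hGi : ∀ t ∈ Icc 0 T, Integrable (G t) := fun t ht =>
    ((hub t ht).integrable_im_conj_mul_lapC.const_mul ε).neg
  have hG1 : ∀ t ∈ Icc 0 T, ∫ x, |G t x| ≤ D * (3 * B ^ 2) := by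
    intro t ht
    simp only [hGdef, abs_neg, abs_mul, abs_of_pos hε]
    rw [integral_const_mul]
    exact mul_le_mul hεD (hub t ht).integral_abs_im_conj_mul_lapC_le
      (integral_nonneg fun x => abs_nonneg _) hD.le
  have hGN : ∀ t ∈ Icc 0 T, ∫ x, |G t x| ≤ (4 + 3 * ε) * B ^ 2 := by
    intro t ht
    simp only [hGdef, abs_neg, abs_mul, abs_of_pos hε]
    rw [integral_const_mul]
    have := mul_le_mul_of_nonneg_left (hub t ht).integral_abs_im_conj_mul_lapC_le hε.le
    linarith
  have heq : ∀ t ∈ Icc 0 T, ∀ x, derivWithin (fun τ => W τ x) (Icc 0 T) t =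
      -(∑ i : Fin 3, pdR i (φ t) x * pdR i (W t) x) - W t x * lapR (φ t) x + G t x := by
    intro t ht x
    have h1 := derivWithin_density hT hu ht (hueq t ht x)
    have h2 := derivWithin_density (e := 0) (c := k t x) hT hv ht (φ := φ) (x := x) (by
      rw [hveq t ht x]; push_cast; ring)
    have hdu := (hasDerivWithinAt_slice (u := fun t x => ‖u t x‖ ^ 2) (hu.norm_sq ℝ)
      ht x).differentiableWithinAt
    have hdv := (hasDerivWithinAt_slice (u := fun t x => ‖v t x‖ ^ 2) (hv.norm_sq ℝ)
      ht x).differentiableWithinAt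
    have h3 : derivWithin (fun τ => W τ x) (Icc 0 T) t = _ := derivWithin_fun_sub hdu hdv
    rw [h3, h1, h2]
    have h4 : ∀ i, pdR i (W t) x =
        pdR i (fun y => ‖u t y‖ ^ 2) x - pdR i (fun y => ‖v t y‖ ^ 2) x := fun i =>
      congrFun ((hub t ht).pdR_norm_sq_sub (hvb t ht) i) x
    simp only [h4, Fin.sum_univ_three]
    simp only [hWdef, hGdef]
    ring
  constructor
  · have key : ∀ n : ℕ, ∫ x, (√(W t x ^ 2 + (1 / ((n : ℝ) + 1)) ^ 2) - 1 / ((n : ℝ) + 1)) ≤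
        exp ((3 * Λ + 1) * T) * ((1 + 4 * B ^ 2) / 2 + T * (3 * B ^ 2)) * D := by
      intro n
      have hδ : 0 < 1 / ((n : ℝ) + 1) := Nat.one_div_pos_of_nat
      set δ := 1 / ((n : ℝ) + 1)
      have hest := transport_convex_estimate (L := 1) (E₀ := D * (3 * B ^ 2))
        (E := fun t x => |G t x|) hT hΛ zero_le_one hW hWi hWN hWM hdi hdN hGi hGN hφ hφ1 hφ2 heq
        (contDiff_sqrt_sq_add_sq hδ) (hasDerivAt_sqrt_sq_add_sq hδ)
        (fun w => sub_nonneg.2 (le_sqrt_sq_add_sq w δ))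
        (fun w _ => by rw [one_mul]; exact sqrt_sq_add_sq_sub_le hδ)
        (fun w _ => abs_div_sqrt_sq_add_sq_le_one hδ)
        (fun w => abs_sqrt_sq_add_sq_sub_le hδ)
        (fun t ht => (hGi t ht).abs) hG1
        (fun t ht x => by
          rw [abs_mul]
          have h1 := mul_le_of_le_one_left (abs_nonneg (G t x))
            (abs_div_sqrt_sq_add_sq_le_one (w := W t x) hδ)
          linarith [le_sqrt_sq_add_sq (W t x) δ])
        (by positivity) ht
      refine hest.trans ?_
      rw [mul_assoc]
      refine mul_le_mul_of_nonneg_left ?_ (exp_pos _).le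
      have h1 : ∫ x, (√(W 0 x ^ 2 + δ ^ 2) - δ) ≤ ∫ x, |W 0 x| :=
        integral_mono_of_nonneg
          (Filter.Eventually.of_forall fun x => sub_nonneg.2 (le_sqrt_sq_add_sq _ δ))
          (hWi 0 hT0).abs (Filter.Eventually.of_forall fun x => sqrt_sq_add_sq_sub_le hδ)
      have h2 := (hub 0 hT0).integral_abs_norm_sq_sub_le_of_integral_norm_sub_sq_le
        (hvb 0 hT0) hD h0
      have h3 := h1.trans h2
      linarith
    refine le_of_tendsto' (tendsto_integral_of_dominated_convergence (fun x => |W t x|) ?_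
      (hWi t ht).abs ?_ ?_) key
    · intro n
      have hc : Continuous (W t) := (contDiff_slice hW ht).continuous
      exact (((hc.pow 2).add continuous_const).sqrt.sub continuous_const).aestronglyMeasurable
    · intro n
      refine Filter.Eventually.of_forall fun x => ?_
      rw [Real.norm_of_nonneg (sub_nonneg.2 (le_sqrt_sq_add_sq _ _))]
      exact sqrt_sq_add_sq_sub_le Nat.one_div_pos_of_nat
    · refine Filter.Eventually.of_forall fun x => ?_
      have h1 : Continuous fun δ : ℝ => √(W t x ^ 2 + δ ^ 2) - δ := by fun_prop
      have h2 := (h1.tendsto 0).comp tendsto_one_div_add_atTop_nhds_zero_nat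
      simpa [Real.sqrt_sq_eq_abs, Function.comp_def] using h2
  · have hest := transport_convex_estimate (L := 2 * M ^ 2) (E₀ := D ^ 2 * (9 * M ^ 2 * B ^ 2))
      (E := fun t x => G t x ^ 2) (h := fun w => w ^ 2) (h' := fun w => 2 * w)
      hT hΛ (by positivity) hW hWi hWN hWM hdi hdN hGi hGN hφ hφ1 hφ2 heq
      (contDiff_id.pow 2) (fun w => by simpa using hasDerivAt_pow 2 w)
      (fun w => sq_nonneg w)
      (fun w hw => by
        rw [← sq_abs]
        nlinarith [abs_nonneg w, mul_le_mul_of_nonneg_right hw (abs_nonneg w), sq_nonneg M,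
          mul_nonneg (sq_nonneg M) (abs_nonneg w)])
      (fun w hw => by rw [abs_mul, abs_two]; linarith)
      (fun w => by
        have : w ^ 2 - 2 * w * w = -w ^ 2 := by ring
        rw [this, abs_neg, abs_of_nonneg (sq_nonneg w)])
      (fun t ht => by
        simp only [hGdef, neg_sq, mul_pow]
        exact (hub t ht).integrable_sq_im_conj_mul_lapC.const_mul _)
      (fun t ht => by
        simp only [hGdef, neg_sq, mul_pow]
        rw [integral_const_mul]
        exact mul_le_mul (pow_le_pow_left₀ hε.le hεD 2)
          (hub t ht).integral_sq_im_conj_mul_lapC_le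
          (integral_nonneg fun x => sq_nonneg _) (sq_nonneg D))
      (fun t ht x => by
        rw [abs_le]
        constructor <;> nlinarith [sq_nonneg (W t x - G t x), sq_nonneg (W t x + G t x)])
      (by positivity) ht
    refine hest.trans ?_
    rw [mul_assoc (exp _)]
    refine mul_le_mul_of_nonneg_left ?_ (exp_pos _).le
    have h2 := (hub 0 hT0).integral_sq_norm_sq_sub_le_of_integral_norm_sub_sq_le (hvb 0 hT0) h0
    have h3 : ∫ x, W 0 x ^ 2 ≤ 4 * M ^ 2 * D ^ 2 := h2
    linarith

theorem rpow_integral_rpow_le {f Y : E3 → ℝ} {A D p : ℝ} (hf : ∀ x, 0 ≤ f x)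
    (hfY : ∀ x, f x ≤ Y x) (hY : Integrable Y) (hY2 : Integrable fun x => Y x ^ 2)
    (hA : 1 ≤ A) (hD : 0 < D) (h1 : ∫ x, Y x ≤ A * D) (h2 : ∫ x, Y x ^ 2 ≤ A * D ^ 2)
    (hp1 : 1 ≤ p) (hp2 : p ≤ 2) :
    (∫ x, f x ^ p) ^ (1 / p) ≤ 2 * A * D := by
  have hp0 : 0 < p := by linarith
  have hpt : ∀ x, f x ^ p ≤ D ^ (p - 1) * Y x + D ^ (p - 2) * Y x ^ 2 := by
    intro x
    have hY0 : 0 ≤ Y x := (hf x).trans (hfY x)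
    refine (Real.rpow_le_rpow (hf x) (hfY x) hp0.le).trans ?_
    rcases le_or_gt (Y x) D with h | h
    · have h3 : Y x ^ p = Y x ^ (p - 1) * Y x := by
        rw [← Real.rpow_add_one' hY0 (by linarith)]
        congr 1; ring
      rw [h3]
      have h4 := mul_le_mul_of_nonneg_right
        (Real.rpow_le_rpow hY0 h (by linarith : 0 ≤ p - 1)) hY0
      have h5 : 0 ≤ D ^ (p - 2) * Y x ^ 2 := by positivity
      linarith
    · have hY1 : 0 < Y x := hD.trans h
      have h3 : Y x ^ p = Y x ^ (p - 2) * Y x ^ 2 := by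
        rw [← Real.rpow_natCast, ← Real.rpow_add hY1]
        congr 1; push_cast; ring
      rw [h3]
      have h4 := mul_le_mul_of_nonneg_right
        (Real.rpow_le_rpow_of_nonpos hD h.le (by linarith : p - 2 ≤ 0)) (sq_nonneg (Y x))
      have h5 : 0 ≤ D ^ (p - 1) * Y x := by positivity
      linarith
  have hInt : ∫ x, f x ^ p ≤ 2 * A * D ^ p := by
    have hi1 := hY.const_mul (D ^ (p - 1))
    have hi2 := hY2.const_mul (D ^ (p - 2))
    calc ∫ x, f x ^ p ≤ ∫ x, (D ^ (p - 1) * Y x + D ^ (p - 2) * Y x ^ 2) :=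
          integral_mono_of_nonneg
            (Filter.Eventually.of_forall fun x => Real.rpow_nonneg (hf x) p) (hi1.add hi2)
            (Filter.Eventually.of_forall hpt)
      _ = D ^ (p - 1) * (∫ x, Y x) + D ^ (p - 2) * ∫ x, Y x ^ 2 := by
          rw [integral_add hi1 hi2, integral_const_mul, integral_const_mul]
      _ ≤ D ^ (p - 1) * (A * D) + D ^ (p - 2) * (A * D ^ 2) := by gcongr
      _ = 2 * A * D ^ p := by
          have e1 : D ^ (p - 1) * D = D ^ p := by
            rw [← Real.rpow_add_one hD.ne']; congr 1; ring
          have e2 : D ^ (p - 2) * D ^ 2 = D ^ p := by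
            rw [← Real.rpow_natCast, ← Real.rpow_add hD]; congr 1; push_cast; ring
          linear_combination A * e1 + A * e2
  calc (∫ x, f x ^ p) ^ (1 / p) ≤ (2 * A * D ^ p) ^ (1 / p) :=
        Real.rpow_le_rpow (integral_nonneg fun x => Real.rpow_nonneg (hf x) p) hInt
          (by positivity)
    _ = (2 * A) ^ (1 / p) * D := by
        rw [Real.mul_rpow (by positivity) (by positivity), ← Real.rpow_mul hD.le,
          mul_one_div_cancel hp0.ne', Real.rpow_one]
    _ ≤ 2 * A * D := by
        refine mul_le_mul_of_nonneg_right ?_ hD.le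
        exact Real.rpow_le_self_of_one_le (by linarith) ((div_le_one hp0).2 hp1)

theorem pd_mul_exp {u : E3 → ℂ} {φ : E3 → ℝ} {x : E3} (ε : ℝ) (hu : DifferentiableAt ℝ u x)
    (hφ : DifferentiableAt ℝ φ x) (i : Fin 3) :
    pd i (fun y => u y * Complex.exp (Complex.I * ((φ y / ε : ℝ) : ℂ))) x =
      (pd i u x + Complex.I * ((pdR i φ x / ε : ℝ) : ℂ) * u x) *
        Complex.exp (Complex.I * ((φ x / ε : ℝ) : ℂ)) := by
  have h1 : HasFDerivAt (fun y => ((φ y / ε : ℝ) : ℂ))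
      (Complex.ofRealCLM.comp (ε⁻¹ • fderiv ℝ φ x)) x := by
    have h0 : HasFDerivAt (fun y => φ y / ε) (ε⁻¹ • fderiv ℝ φ x) x := by
      simpa only [div_eq_mul_inv] using hφ.hasFDerivAt.mul_const ε⁻¹
    exact Complex.ofRealCLM.hasFDerivAt.comp x h0
  have h2 := hu.hasFDerivAt.fun_mul (h1.const_mul Complex.I).cexp
  rw [pd, h2.fderiv]
  simp [pd, pdR]
  ring

theorem mul_im_conj_pd_mul_exp {u : E3 → ℂ} {φ : E3 → ℝ} {x : E3} {ε : ℝ} (hε : ε ≠ 0)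
    (hu : DifferentiableAt ℝ u x) (hφ : DifferentiableAt ℝ φ x) (i : Fin 3) :
    ε * (pd i (fun y => u y * Complex.exp (Complex.I * ((φ y / ε : ℝ) : ℂ))) x *
        (starRingEnd ℂ) (u x * Complex.exp (Complex.I * ((φ x / ε : ℝ) : ℂ)))).im =
      ε * (pd i u x * (starRingEnd ℂ) (u x)).im + ‖u x‖ ^ 2 * pdR i φ x := by
  rw [pd_mul_exp ε hu hφ, map_mul, mul_mul_mul_comm, Complex.mul_conj',
    Complex.norm_exp_I_mul_ofReal, ← Complex.normSq_eq_norm_sq, Complex.normSq_apply]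
  simp
  field_simp
  ring

theorem sq_mul_norm_sq_pd_mul_exp {u : E3 → ℂ} {φ : E3 → ℝ} {x : E3} {ε : ℝ} (hε : ε ≠ 0)
    (hu : DifferentiableAt ℝ u x) (hφ : DifferentiableAt ℝ φ x) (i : Fin 3) :
    ε ^ 2 * ‖pd i (fun y => u y * Complex.exp (Complex.I * ((φ y / ε : ℝ) : ℂ))) x‖ ^ 2 =
      ε ^ 2 * ‖pd i u x‖ ^ 2 + ‖u x‖ ^ 2 * pdR i φ x ^ 2 +
        2 * ε * pdR i φ x * (pd i u x * (starRingEnd ℂ) (u x)).im := by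
  rw [pd_mul_exp ε hu hφ, norm_mul, Complex.norm_exp_I_mul_ofReal, mul_one]
  simp only [← Complex.normSq_eq_norm_sq, Complex.normSq_apply]
  simp
  field_simp
  ring

namespace SobolevBounds

variable {M B : ℝ} {u v : E3 → ℂ} {φ : E3 → ℝ}

theorem pd_mul_le (i : Fin 3) (x : E3) :
    ‖pd i u x‖ * ‖u x‖ ≤ (‖pd i u x‖ ^ 2 + ‖u x‖ ^ 2) / 2 := by
  linarith [two_mul_le_add_sq ‖pd i u x‖ ‖u x‖]

theorem continuous_norm_pd_mul (hu : SobolevBounds M B u) (i : Fin 3) :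
    Continuous fun x => ‖pd i u x‖ * ‖u x‖ :=
  (continuous_pd (hu.contDiff.of_le one_le_two) i).norm.mul hu.contDiff.continuous.norm

theorem integrable_norm_pd_mul (hu : SobolevBounds M B u) (i : Fin 3) :
    Integrable fun x => ‖pd i u x‖ * ‖u x‖ := by
  refine (((hu.integrable_pd_sq i).add hu.integrable_sq).div_const 2).mono'
    (hu.continuous_norm_pd_mul i).aestronglyMeasurable (Filter.Eventually.of_forall fun x => ?_)
  rw [Real.norm_of_nonneg (by positivity)]
  exact pd_mul_le i x

theorem integral_norm_pd_mul_le (hu : SobolevBounds M B u) (i : Fin 3) :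
    ∫ x, ‖pd i u x‖ * ‖u x‖ ≤ B ^ 2 := by
  refine (integral_mono (hu.integrable_norm_pd_mul i)
    (((hu.integrable_pd_sq i).add hu.integrable_sq).div_const 2) (pd_mul_le i)).trans ?_
  simp only [Pi.add_apply]
  rw [integral_div, integral_add (hu.integrable_pd_sq i) hu.integrable_sq]
  linarith [hu.integral_sq_le, hu.integral_pd_sq_le i]

theorem norm_pd_mul_sq_le (hu : SobolevBounds M B u) (i : Fin 3) (x : E3) :
    (‖pd i u x‖ * ‖u x‖) ^ 2 ≤ M ^ 2 * ‖pd i u x‖ ^ 2 := by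
  rw [mul_pow, mul_comm]
  exact mul_le_mul_of_nonneg_right (pow_le_pow_left₀ (norm_nonneg _) (hu.norm_le x) 2)
    (sq_nonneg _)

theorem integrable_norm_pd_mul_sq (hu : SobolevBounds M B u) (i : Fin 3) :
    Integrable fun x => (‖pd i u x‖ * ‖u x‖) ^ 2 := by
  refine ((hu.integrable_pd_sq i).const_mul (M ^ 2)).mono'
    ((hu.continuous_norm_pd_mul i).pow 2).aestronglyMeasurable
    (Filter.Eventually.of_forall fun x => ?_)
  rw [Real.norm_of_nonneg (sq_nonneg _)]
  exact hu.norm_pd_mul_sq_le i x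

theorem integral_norm_pd_mul_sq_le (hu : SobolevBounds M B u) (i : Fin 3) :
    ∫ x, (‖pd i u x‖ * ‖u x‖) ^ 2 ≤ M ^ 2 * B ^ 2 := by
  refine (integral_mono (hu.integrable_norm_pd_mul_sq i)
    ((hu.integrable_pd_sq i).const_mul (M ^ 2)) (hu.norm_pd_mul_sq_le i)).trans ?_
  rw [integral_const_mul]
  exact mul_le_mul_of_nonneg_left (hu.integral_pd_sq_le i) (sq_nonneg M)

theorem abs_im_pd_mul_conj_le (i : Fin 3) (x : E3) :
    |(pd i u x * (starRingEnd ℂ) (u x)).im| ≤ ‖pd i u x‖ * ‖u x‖ := by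
  refine (Complex.abs_im_le_norm _).trans (le_of_eq ?_)
  rw [norm_mul, RCLike.norm_conj]

theorem sqrt_current_difference_le (hu : SobolevBounds M B u) (hφ : Differentiable ℝ φ)
    {ε Λ : ℝ} (hε : 0 < ε) (hφ1 : ∀ i x, |pdR i φ x| ≤ Λ) {g : E3 → ℂ}
    (hg : ∀ x, g x = u x * Complex.exp (Complex.I * ((φ x / ε : ℝ) : ℂ))) (x : E3) :
    √(∑ i : Fin 3, (ε * (pd i g x * (starRingEnd ℂ) (g x)).im
        - ‖v x‖ ^ 2 * pdR i φ x) ^ 2) ≤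
      ∑ i : Fin 3, (ε * (‖pd i u x‖ * ‖u x‖) + Λ * |‖u x‖ ^ 2 - ‖v x‖ ^ 2|) := by
  have hV : ∀ i, |ε * (pd i g x * (starRingEnd ℂ) (g x)).im - ‖v x‖ ^ 2 * pdR i φ x| ≤
      ε * (‖pd i u x‖ * ‖u x‖) + Λ * |‖u x‖ ^ 2 - ‖v x‖ ^ 2| := by
    intro i
    rw [funext hg, mul_im_conj_pd_mul_exp hε.ne'
      (hu.contDiff.differentiable two_ne_zero x) (hφ x)]
    rw [add_sub_assoc, ← sub_mul]
    refine (abs_add_le _ _).trans (add_le_add ?_ ?_)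
    · rw [abs_mul, abs_of_pos hε]
      exact mul_le_mul_of_nonneg_left (abs_im_pd_mul_conj_le i x) hε.le
    · rw [abs_mul, mul_comm]
      exact mul_le_mul_of_nonneg_right (hφ1 i x) (abs_nonneg _)
  refine le_trans ?_ (Finset.sum_le_sum fun i _ => hV i)
  refine Real.sqrt_le_iff.2 ⟨Finset.sum_nonneg fun i _ => abs_nonneg _, ?_⟩
  simp only [← sq_abs (_ - _)]
  exact Finset.sum_sq_le_sq_sum_of_nonneg fun i _ => abs_nonneg _

theorem rpow_integral_current_difference_le (hu : SobolevBounds M B u)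
    (hv : SobolevBounds M B v) (hφ : Differentiable ℝ φ) {ε Λ D p C₁ C₂ : ℝ} (hε : 0 < ε)
    (hεD : ε ≤ D) (hΛ : 0 ≤ Λ) (hφ1 : ∀ i x, |pdR i φ x| ≤ Λ) {g : E3 → ℂ}
    (hg : ∀ x, g x = u x * Complex.exp (Complex.I * ((φ x / ε : ℝ) : ℂ)))
    (h1 : ∫ x, |‖u x‖ ^ 2 - ‖v x‖ ^ 2| ≤ C₁ * D) (hC₁ : 0 ≤ C₁)
    (h2 : ∫ x, (‖u x‖ ^ 2 - ‖v x‖ ^ 2) ^ 2 ≤ C₂ * D ^ 2) (hC₂ : 0 ≤ C₂)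
    (hp1 : 1 ≤ p) (hp2 : p ≤ 2) :
    (∫ x, (√(∑ i : Fin 3, (ε * (pd i g x * (starRingEnd ℂ) (g x)).im
        - ‖v x‖ ^ 2 * pdR i φ x) ^ 2)) ^ p) ^ (1 / p) ≤
      2 * (1 + 3 * (B ^ 2 + Λ * C₁) + 18 * (M ^ 2 * B ^ 2 + Λ ^ 2 * C₂)) * D := by
  have hD : 0 < D := hε.trans_le hεD
  have hW := (hu.integrable_norm_sq_sub hv).abs.const_mul Λ
  have hP : ∀ i, Integrable fun x => ε * (‖pd i u x‖ * ‖u x‖) := fun i =>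
    (hu.integrable_norm_pd_mul i).const_mul ε
  have hPW : ∀ i, Integrable fun x =>
      ε * (‖pd i u x‖ * ‖u x‖) + Λ * |‖u x‖ ^ 2 - ‖v x‖ ^ 2| := fun i => (hP i).add hW
  have hY := integrable_finsetSum Finset.univ fun (i : Fin 3) _ => hPW i
  have hW2 := (hu.integrable_sq_norm_sq_sub hv).const_mul (Λ ^ 2)
  have hP2 : ∀ i, Integrable fun x => ε ^ 2 * (‖pd i u x‖ * ‖u x‖) ^ 2 := fun i =>
    (hu.integrable_norm_pd_mul_sq i).const_mul (ε ^ 2)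
  have hPW2 : ∀ i, Integrable fun x => ε ^ 2 * (‖pd i u x‖ * ‖u x‖) ^ 2 +
      Λ ^ 2 * (‖u x‖ ^ 2 - ‖v x‖ ^ 2) ^ 2 := fun i => (hP2 i).add hW2
  have hZ := (integrable_finsetSum Finset.univ fun (i : Fin 3) _ => hPW2 i).const_mul 6
  have hYZ : ∀ x, (∑ i : Fin 3, (ε * (‖pd i u x‖ * ‖u x‖) +
      Λ * |‖u x‖ ^ 2 - ‖v x‖ ^ 2|)) ^ 2 ≤ 6 * ∑ i : Fin 3,
      (ε ^ 2 * (‖pd i u x‖ * ‖u x‖) ^ 2 + Λ ^ 2 * (‖u x‖ ^ 2 - ‖v x‖ ^ 2) ^ 2) := by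
    intro x
    refine sq_sum_le_card_mul_sum_sq.trans ?_
    simp only [Finset.card_univ, Fintype.card_fin, Nat.cast_ofNat]
    rw [show (6 : ℝ) = 3 * 2 by norm_num, mul_assoc, Finset.mul_sum Finset.univ _ (2 : ℝ)]
    refine mul_le_mul_of_nonneg_left (Finset.sum_le_sum fun i _ => ?_) (by norm_num)
    rw [← sq_abs (‖u x‖ ^ 2 - ‖v x‖ ^ 2)]
    nlinarith [two_mul_le_add_sq (ε * (‖pd i u x‖ * ‖u x‖)) (Λ * |‖u x‖ ^ 2 - ‖v x‖ ^ 2|)]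
  have hY2 : Integrable fun x => (∑ i : Fin 3, (ε * (‖pd i u x‖ * ‖u x‖) +
      Λ * |‖u x‖ ^ 2 - ‖v x‖ ^ 2|)) ^ 2 := by
    refine hZ.mono' (hY.aestronglyMeasurable.pow 2) (Filter.Eventually.of_forall fun x => ?_)
    rw [Real.norm_of_nonneg (sq_nonneg _)]
    exact hYZ x
  have hB2 := sq_nonneg B
  have hM2 := sq_nonneg M
  have hn1 : 0 ≤ Λ * C₁ := mul_nonneg hΛ hC₁
  have hn2 : 0 ≤ Λ ^ 2 * C₂ := by positivity
  have hn3 : 0 ≤ M ^ 2 * B ^ 2 := by positivity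
  refine rpow_integral_rpow_le (fun x => Real.sqrt_nonneg _)
    (hu.sqrt_current_difference_le hφ hε hφ1 hg) hY hY2 (by linarith) hD ?_ ?_ hp1 hp2
  · rw [integral_finsetSum _ fun i _ => hPW i]
    have h3 : ∀ i : Fin 3, ∫ x, (ε * (‖pd i u x‖ * ‖u x‖) +
        Λ * |‖u x‖ ^ 2 - ‖v x‖ ^ 2|) ≤ (B ^ 2 + Λ * C₁) * D := fun i => by
      rw [integral_add (hP i) hW, integral_const_mul, integral_const_mul]
      have h4 := mul_le_mul_of_nonneg_left (hu.integral_norm_pd_mul_le i) hε.le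
      have h5 := mul_le_mul_of_nonneg_left h1 hΛ
      have h6 := mul_le_mul_of_nonneg_right hεD hB2
      linarith
    refine (Finset.sum_le_sum fun i _ => h3 i).trans ?_
    simp only [Finset.sum_const, Finset.card_univ, Fintype.card_fin, nsmul_eq_mul,
      Nat.cast_ofNat]
    rw [← mul_assoc]
    exact mul_le_mul_of_nonneg_right (by linarith) hD.le
  · refine (integral_mono hY2 hZ hYZ).trans ?_
    rw [integral_const_mul, integral_finsetSum _ fun i _ => hPW2 i]
    have h3 : ∀ i : Fin 3, ∫ x, (ε ^ 2 * (‖pd i u x‖ * ‖u x‖) ^ 2 +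
        Λ ^ 2 * (‖u x‖ ^ 2 - ‖v x‖ ^ 2) ^ 2) ≤ (M ^ 2 * B ^ 2 + Λ ^ 2 * C₂) * D ^ 2 := fun i => by
      rw [integral_add (hP2 i) hW2, integral_const_mul, integral_const_mul]
      have h4 := mul_le_mul_of_nonneg_left (hu.integral_norm_pd_mul_sq_le i) (sq_nonneg ε)
      have h5 := mul_le_mul_of_nonneg_left h2 (sq_nonneg Λ)
      have h6 := mul_le_mul_of_nonneg_right (pow_le_pow_left₀ hε.le hεD 2) hn3
      linarith
    have h4 := Finset.sum_le_sum fun i (_ : i ∈ Finset.univ) => h3 i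
    simp only [Finset.sum_const, Finset.card_univ, Fintype.card_fin, nsmul_eq_mul,
      Nat.cast_ofNat] at h4
    have h5 : 18 * (M ^ 2 * B ^ 2 + Λ ^ 2 * C₂) * D ^ 2 ≤
        (1 + 3 * (B ^ 2 + Λ * C₁) + 18 * (M ^ 2 * B ^ 2 + Λ ^ 2 * C₂)) * D ^ 2 :=
      mul_le_mul_of_nonneg_right (by linarith) (sq_nonneg D)
    linarith

theorem integral_kinetic_difference_le (hu : SobolevBounds M B u)
    (hv : SobolevBounds M B v) (hφ : Differentiable ℝ φ) {ε Λ D C₁ : ℝ} (hε : 0 < ε)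
    (hε1 : ε ≤ 1) (hεD : ε ≤ D) (hΛ : 0 ≤ Λ) (hφ1 : ∀ i x, |pdR i φ x| ≤ Λ) {g : E3 → ℂ}
    (hg : ∀ x, g x = u x * Complex.exp (Complex.I * ((φ x / ε : ℝ) : ℂ)))
    (h1 : ∫ x, |‖u x‖ ^ 2 - ‖v x‖ ^ 2| ≤ C₁ * D) :
    ∫ x, |ε ^ 2 * (∑ i : Fin 3, ‖pd i g x‖ ^ 2)
        - ‖v x‖ ^ 2 * (∑ i : Fin 3, (pdR i φ x) ^ 2)| ≤
      3 * (B ^ 2 + 2 * Λ * B ^ 2 + Λ ^ 2 * C₁) * D := by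
  have hi1 : ∀ i, Integrable fun x => ε ^ 2 * ‖pd i u x‖ ^ 2 := fun i =>
    (hu.integrable_pd_sq i).const_mul _
  have hi2 : ∀ i, Integrable fun x => 2 * ε * Λ * (‖pd i u x‖ * ‖u x‖) := fun i =>
    (hu.integrable_norm_pd_mul i).const_mul _
  have hi3 := (hu.integrable_norm_sq_sub hv).abs.const_mul (Λ ^ 2)
  have hi12 : ∀ i, Integrable fun x => ε ^ 2 * ‖pd i u x‖ ^ 2 +
      2 * ε * Λ * (‖pd i u x‖ * ‖u x‖) := fun i => (hi1 i).add (hi2 i)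
  have hi : ∀ i, Integrable fun x => ε ^ 2 * ‖pd i u x‖ ^ 2 +
      2 * ε * Λ * (‖pd i u x‖ * ‖u x‖) + Λ ^ 2 * |‖u x‖ ^ 2 - ‖v x‖ ^ 2| :=
    fun i => (hi12 i).add hi3
  have hpt : ∀ x, |ε ^ 2 * (∑ i : Fin 3, ‖pd i g x‖ ^ 2)
      - ‖v x‖ ^ 2 * (∑ i : Fin 3, (pdR i φ x) ^ 2)| ≤ ∑ i : Fin 3, (ε ^ 2 * ‖pd i u x‖ ^ 2 +
      2 * ε * Λ * (‖pd i u x‖ * ‖u x‖) + Λ ^ 2 * |‖u x‖ ^ 2 - ‖v x‖ ^ 2|) := by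
    intro x
    rw [Finset.mul_sum, Finset.mul_sum, ← Finset.sum_sub_distrib]
    refine (Finset.abs_sum_le_sum_abs _ _).trans (Finset.sum_le_sum fun i _ => ?_)
    rw [funext hg, sq_mul_norm_sq_pd_mul_exp hε.ne'
      (hu.contDiff.differentiable two_ne_zero x) (hφ x)]
    have hsplit : ε ^ 2 * ‖pd i u x‖ ^ 2 + ‖u x‖ ^ 2 * pdR i φ x ^ 2 +
        2 * ε * pdR i φ x * (pd i u x * (starRingEnd ℂ) (u x)).im - ‖v x‖ ^ 2 * pdR i φ x ^ 2 =
        ε ^ 2 * ‖pd i u x‖ ^ 2 + 2 * ε * pdR i φ x * (pd i u x * (starRingEnd ℂ) (u x)).im +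
        pdR i φ x ^ 2 * (‖u x‖ ^ 2 - ‖v x‖ ^ 2) := by ring
    rw [hsplit]
    refine (abs_add_le _ _).trans (add_le_add ((abs_add_le _ _).trans (add_le_add ?_ ?_)) ?_)
    · rw [abs_of_nonneg (by positivity)]
    · rw [abs_mul, abs_mul, abs_of_pos (by positivity : 0 < 2 * ε)]
      have h2 := hφ1 i x
      have h3 := abs_im_pd_mul_conj_le (u := u) i x
      gcongr
    · rw [abs_mul, abs_of_nonneg (sq_nonneg _), ← sq_abs (pdR i φ x)]
      have h2 := hφ1 i x
      gcongr
  refine (integral_mono_of_nonneg (Filter.Eventually.of_forall fun x => abs_nonneg _)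
    (integrable_finsetSum _ fun i _ => hi i) (Filter.Eventually.of_forall hpt)).trans ?_
  rw [integral_finsetSum _ fun i _ => hi i]
  have hB2 := sq_nonneg B
  have h3 : ∀ i : Fin 3, ∫ x, (ε ^ 2 * ‖pd i u x‖ ^ 2 +
      2 * ε * Λ * (‖pd i u x‖ * ‖u x‖) + Λ ^ 2 * |‖u x‖ ^ 2 - ‖v x‖ ^ 2|) ≤
      (B ^ 2 + 2 * Λ * B ^ 2 + Λ ^ 2 * C₁) * D := fun i => by
    rw [integral_add (hi12 i) hi3, integral_add (hi1 i) (hi2 i), integral_const_mul,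
      integral_const_mul, integral_const_mul]
    have hεsq : ε ^ 2 ≤ D := by nlinarith
    have h4 : ε ^ 2 * (∫ x, ‖pd i u x‖ ^ 2) ≤ D * B ^ 2 :=
      (mul_le_mul_of_nonneg_left (hu.integral_pd_sq_le i) (sq_nonneg ε)).trans
        (mul_le_mul_of_nonneg_right hεsq hB2)
    have h5 : 2 * ε * Λ * (∫ x, ‖pd i u x‖ * ‖u x‖) ≤ 2 * D * Λ * B ^ 2 :=
      (mul_le_mul_of_nonneg_left (hu.integral_norm_pd_mul_le i) (by positivity)).trans
        (by gcongr)
    have h6 := mul_le_mul_of_nonneg_left h1 (sq_nonneg Λ)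
    linarith
  refine (Finset.sum_le_sum fun i _ => h3 i).trans (le_of_eq ?_)
  simp only [Finset.sum_const, Finset.card_univ, Fintype.card_fin, nsmul_eq_mul,
    Nat.cast_ofNat]
  ring

end SobolevBounds

/-- **WKB derivation of the mass, momentum and kinetic-energy densities of the eikonal
system in the critical beyond-Gross–Pitaevskii regime `κ = 1/2`.**  With
`φ^ε = a^ε e^{iφ_eik/ε}` for a solution `a^ε` of the amplitude equation and `a` a solution
of the limiting eikonal amplitude equation with capacity constant `𝔠₀`, the densities
`ρ^ε = |φ^ε|²`, `J^ε = Im(ε∇φ^ε conj(φ^ε))` and `|ε∇φ^ε|²` converge in `L^p` (resp. `L¹`)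
to `|a|²`, `|a|²∇φ_eik` and `|a|²|∇φ_eik|²` with rate
`D = ‖a^ε(0) - a(0)‖_{H^s} + ε + η₁ + η₂`. -/
theorem wkb_density_convergence_critical
    (s : ℕ) (hs : 2 ≤ s) (T₀ Λ B c₀ p : ℝ)
    (hT₀ : 0 < T₀) (hΛ : 1 ≤ Λ) (hB : 1 ≤ B) (hc₀ : 0 < c₀)
    (hp1 : 1 ≤ p) (hp2 : p ≤ 2) :
    ∃ C > (0 : ℝ),
      ∀ η₁ η₂ : ℝ, 0 ≤ η₁ → 0 ≤ η₂ →
      ∀ ε : ℝ, 0 < ε → ε ≤ 1 →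
      ∀ φeik : ℝ → E3 → ℝ,
        (∀ n : ℕ, ContDiffOn ℝ n (fun q : ℝ × E3 => φeik q.1 q.2)
          (Set.Icc 0 T₀ ×ˢ Set.univ)) →
        (∀ σ : Fin 3 → ℕ, 1 ≤ mdeg σ → mdeg σ ≤ s + 2 →
          ∀ t ∈ Set.Icc (0 : ℝ) T₀, ∀ x, |mpdR σ (φeik t) x| ≤ Λ) →
      ∀ K : E3 → ℝ, Integrable K → (∀ x, 0 ≤ K x) →
        ε⁻¹ * (∫ x : E3, |K x|) ≤ Λ →
        |ε⁻¹ * (∫ x : E3, K x) - 4 * Real.pi * c₀| ≤ η₁ →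
        ε⁻¹ * (∫ x : E3, ‖x‖ * K x) ≤ η₂ →
      ∀ aε : ℝ → E3 → ℂ,
        (∀ n : ℕ, ContDiffOn ℝ n (fun q : ℝ × E3 => aε q.1 q.2)
          (Set.Icc 0 T₀ ×ˢ Set.univ)) →
        (∀ t ∈ Set.Icc (0 : ℝ) T₀, IsSchwartzF (aε t)) →
        (∀ t ∈ Set.Icc (0 : ℝ) T₀, ∀ x : E3,
          derivWithin (fun τ => aε τ x) (Set.Icc 0 T₀) t
            + (∑ i : Fin 3, (pdR i (φeik t) x : ℂ) * pd i (aε t) x)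
            + (1 / 2 : ℂ) * aε t x * (lapR (φeik t) x : ℂ)
          = Complex.I * ((ε : ℂ) / 2) * lapC (aε t) x
            - Complex.I * (ε : ℂ)⁻¹ *
                (conv3 K (fun y => ‖aε t y‖ ^ 2) x : ℂ) * aε t x) →
        (∀ t ∈ Set.Icc (0 : ℝ) T₀, sobNorm s (aε t) ≤ B) →
      ∀ a : ℝ → E3 → ℂ,
        (∀ n : ℕ, ContDiffOn ℝ n (fun q : ℝ × E3 => a q.1 q.2)
          (Set.Icc 0 T₀ ×ˢ Set.univ)) →
        (∀ t ∈ Set.Icc (0 : ℝ) T₀, IsSchwartzF (a t)) →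
        (∀ t ∈ Set.Icc (0 : ℝ) T₀, ∀ x : E3,
          derivWithin (fun τ => a τ x) (Set.Icc 0 T₀) t
            + (∑ i : Fin 3, (pdR i (φeik t) x : ℂ) * pd i (a t) x)
            + (1 / 2 : ℂ) * a t x * (lapR (φeik t) x : ℂ)
          = -Complex.I * ((4 * Real.pi * c₀ : ℝ) : ℂ) *
              ((‖a t x‖ ^ 2 : ℝ) : ℂ) * a t x) →
        (∀ t ∈ Set.Icc (0 : ℝ) T₀, sobNorm (s + 2) (a t) ≤ B) →
      -- φ^ε := a^ε e^{iφ_eik/ε}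
      ∀ φε : ℝ → E3 → ℂ,
        (∀ t x, φε t x = aε t x * Complex.exp (Complex.I * ((φeik t x / ε : ℝ) : ℂ))) →
      ∀ t ∈ Set.Icc (0 : ℝ) T₀,
        (∫ x : E3, |‖φε t x‖ ^ 2 - ‖a t x‖ ^ 2| ^ p) ^ (1 / p)
            ≤ C * (sobNorm s (fun x => aε 0 x - a 0 x) + ε + η₁ + η₂) ∧
        (∫ x : E3, (Real.sqrt (∑ i : Fin 3,
              (ε * (pd i (φε t) x * (starRingEnd ℂ) (φε t x)).im
                - ‖a t x‖ ^ 2 * pdR i (φeik t) x) ^ 2)) ^ p) ^ (1 / p)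
            ≤ C * (sobNorm s (fun x => aε 0 x - a 0 x) + ε + η₁ + η₂) ∧
        (∫ x : E3,
              |ε ^ 2 * (∑ i : Fin 3, ‖pd i (φε t) x‖ ^ 2)
                - ‖a t x‖ ^ 2 * (∑ i : Fin 3, (pdR i (φeik t) x) ^ 2)|)
            ≤ C * (sobNorm s (fun x => aε 0 x - a 0 x) + ε + η₁ + η₂) := by
  obtain ⟨M, hM, hbounds⟩ := exists_sobolevBounds B
  set C₁ := exp ((3 * Λ + 1) * T₀) * ((1 + 4 * B ^ 2) / 2 + T₀ * (3 * B ^ 2)) with hC₁_def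
  set C₂ := exp ((3 * Λ + 1) * T₀) * (4 * M ^ 2 + T₀ * (9 * M ^ 2 * B ^ 2)) with hC₂_def
  have hC₁ : 0 ≤ C₁ := by positivity
  have hC₂ : 0 ≤ C₂ := by positivity
  have hΛ0 : 0 ≤ Λ := by linarith
  set K₁ := 2 * (1 + C₁ + C₂) with hK₁
  set K₂ := 2 * (1 + 3 * (B ^ 2 + Λ * C₁) + 18 * (M ^ 2 * B ^ 2 + Λ ^ 2 * C₂)) with hK₂
  set K₃ := 3 * (B ^ 2 + 2 * Λ * B ^ 2 + Λ ^ 2 * C₁) with hK₃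
  have hK₁0 : 0 < K₁ := by positivity
  have hK₂0 : 0 < K₂ := by positivity
  have hK₃0 : 0 ≤ K₃ := by positivity
  refine ⟨K₁ + K₂ + K₃, by positivity, ?_⟩
  intro η₁ η₂ hη₁ hη₂ ε hε hε1 φeik hφs hφb K _ _ _ _ _ aε haεs haεS haεeq haεB a has haS haeq
    haB φε hφε t ht
  have hN : 0 ≤ sobNorm s fun x => aε 0 x - a 0 x := Real.sqrt_nonneg _
  set D := sobNorm s (fun x => aε 0 x - a 0 x) + ε + η₁ + η₂ with hD_def
  have hεD : ε ≤ D := by linarith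
  have hD : 0 < D := hε.trans_le hεD
  have hub : ∀ t ∈ Icc 0 T₀, SobolevBounds M B (aε t) := fun t ht =>
    hbounds s hs _ (haεS t ht) (haεB t ht)
  have hvb : ∀ t ∈ Icc 0 T₀, SobolevBounds M B (a t) := fun t ht =>
    hbounds (s + 2) (by omega) _ (haS t ht) (haB t ht)
  have hφ : ∀ t ∈ Icc 0 T₀, ContDiff ℝ 2 (φeik t) := fun t ht => contDiff_slice (hφs 2) ht
  have hφ1 : ∀ t ∈ Icc 0 T₀, ∀ i x, |pdR i (φeik t) x| ≤ Λ := fun t ht i x => by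
    rw [← mpdR_single_one]
    exact hφb _ (by rw [mdeg_single]) (by rw [mdeg_single]; omega) t ht x
  have hφ2 : ∀ t ∈ Icc 0 T₀, ∀ i x, |pdR i (pdR i (φeik t)) x| ≤ Λ := fun t ht i x => by
    rw [← mpdR_single_two]
    exact hφb _ (by rw [mdeg_single]; omega) (by rw [mdeg_single]; omega) t ht x
  have h0 : ∫ x, ‖aε 0 x - a 0 x‖ ^ 2 ≤ D ^ 2 :=
    (integral_mpd_le (s := s) (σ := 0) (by simp [mdeg]) fun x => aε 0 x - a 0 x).trans
      (pow_le_pow_left₀ hN (by linarith) 2)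
  obtain ⟨hL1, hL2⟩ := density_difference_estimate hT₀ hΛ0 hε hεD
    (c := fun t x => ε⁻¹ * conv3 K (fun y => ‖aε t y‖ ^ 2) x)
    (k := fun t x => 4 * π * c₀ * ‖a t x‖ ^ 2) (haεs 1) (has 1) hub hvb hφ hφ1 hφ2
    (fun t ht x => by rw [haεeq t ht x]; push_cast; ring)
    (fun t ht x => by rw [haeq t ht x]; push_cast; ring) h0 ht
  rw [← hC₁_def] at hL1
  rw [← hC₂_def] at hL2
  have hdφ := (hφ t ht).differentiable two_ne_zero
  refine ⟨?_, ?_, ?_⟩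
  · have hnorm : ∀ x, ‖φε t x‖ = ‖aε t x‖ := fun x => by
      rw [hφε, norm_mul, Complex.norm_exp_I_mul_ofReal, mul_one]
    simp only [hnorm]
    refine (rpow_integral_rpow_le (A := 1 + C₁ + C₂) (fun x => abs_nonneg _) (fun x => le_rfl)
      ((hub t ht).integrable_norm_sq_sub (hvb t ht)).abs ?_ (by linarith) hD ?_ ?_ hp1
      hp2).trans (mul_le_mul_of_nonneg_right (by linarith) hD.le)
    · simp only [sq_abs]
      exact (hub t ht).integrable_sq_norm_sq_sub (hvb t ht)
    · exact hL1.trans (mul_le_mul_of_nonneg_right (by linarith) hD.le)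
    · simp only [sq_abs]
      exact hL2.trans (mul_le_mul_of_nonneg_right (by linarith) (sq_nonneg D))
  · exact ((hub t ht).rpow_integral_current_difference_le (hvb t ht) hdφ hε hεD hΛ0 (hφ1 t ht)
      (hφε t) hL1 hC₁ hL2 hC₂ hp1 hp2).trans (mul_le_mul_of_nonneg_right (by linarith) hD.le)
  · exact ((hub t ht).integral_kinetic_difference_le (hvb t ht) hdφ hε hε1 hεD hΛ0 (hφ1 t ht)
      (hφε t) hL1).trans (mul_le_mul_of_nonneg_right (by linarith) hD.le)
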